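/- arXiv:2106.06572 — 2 statements merged into one kernel-verified Lean document; each statement's English description precedes it below -/
import Mathlib

section
/- Let Y be the set of real numbers [0; a1, a2, …] whose continued fraction partial quotients all lie in {1,2} and whose digit sequence contains none of the following twenty-five strings, nor their reverses, as a consecutive substring: 21212, 21112121, 211121222, 111112121, 12111212, 111212111, 21112122112, 222111212211, 12211112121122, 112211121221111, 22111121211221, 21122111212211, 2111212211112, 22221111212112222, 21111221112122111221, 21211112211121221112222, 2212211121221111112, 21221221112122111111, 122122111212211111111, 111221221112122111111122, 22221221112122111111112, 212222111121211222112, 1112222111121211222112, 12122221111212112221111, 21222211112121122211112. Then dim_H Y > 0.5. -/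
open Filter

/-- Numerators of the convergents of the continued fraction `[a 0; a 1, a 2, …]`. -/
def cfNum (a : ℕ → ℕ) : ℕ → ℕ
  | 0 => a 0
  | 1 => a 1 * a 0 + 1
  | n + 2 => a (n + 2) * cfNum a (n + 1) + cfNum a n

/-- Denominators of the convergents of the continued fraction `[a 0; a 1, a 2, …]`. -/
def cfDen (a : ℕ → ℕ) : ℕ → ℕ
  | 0 => 1
  | 1 => a 1
  | n + 2 => a (n + 2) * cfDen a (n + 1) + cfDen a n

/-- Value of the infinite continued fraction `[a 0; a 1, a 2, …]` (the limit of its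
convergents). -/
noncomputable def cfVal (a : ℕ → ℕ) : ℝ :=
  limUnder atTop fun n => (cfNum a n : ℝ) / (cfDen a n)

/-- Value of the infinite continued fraction `[0; a 0, a 1, …]`. -/
noncomputable def cf01 (a : ℕ → ℕ) : ℝ := 1 / cfVal a

/-- `λ₀(α) = [α 0; α 1, α 2, …] + [0; α (-1), α (-2), …]`. -/
noncomputable def lambda0 (α : ℤ → ℕ) : ℝ :=
  cfVal (fun n : ℕ => α (n : ℤ)) + cf01 (fun n : ℕ => α (-((n : ℤ) + 1)))

/-- The shift `σ^N` on bi-infinite sequences. -/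
def shiftZ (N : ℤ) (α : ℤ → ℕ) : ℤ → ℕ := fun i => α (i + N)

/-- The Markov value `m(α) = sup_{n ∈ ℤ} λ₀(σⁿ α)`. -/
noncomputable def markovValue (α : ℤ → ℕ) : ℝ := ⨆ n : ℤ, lambda0 (shiftZ n α)

/-- The Lagrange value `ℓ(α) = limsup_{n → +∞} λ₀(σⁿ α)`. -/
noncomputable def lagrangeValue (α : ℤ → ℕ) : ℝ :=
  limsup (fun n : ℕ => lambda0 (shiftZ (n : ℤ) α)) atTop

/-- The Markov spectrum `M`. -/
def MarkovSpectrum : Set ℝ :=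
  { x | ∃ α : ℤ → ℕ, (∀ i, 1 ≤ α i) ∧ markovValue α = x }

/-- The Lagrange spectrum `L`. -/
def LagrangeSpectrum : Set ℝ :=
  { x | ∃ α : ℤ → ℕ, (∀ i, 1 ≤ α i) ∧ lagrangeValue α = x }

/-- The finite word `w` occurs in the one-sided sequence `a` starting at position `i`. -/
def occursAtN (a : ℕ → ℕ) (i : ℕ) (w : List ℕ) : Prop :=
  ∀ j < w.length, a (i + j) = w.getD j 0

/-- The Gauss–Cantor set of reals `[0; a₁, a₂, …]` whose partial quotients all lie in `D`
and whose digit sequence contains no word of `F`, nor the reverse of a word of `F`, as a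
consecutive substring. -/
noncomputable def gaussCantorRev (D : Set ℕ) (F : List (List ℕ)) : Set ℝ :=
  { x | ∃ a : ℕ → ℕ, (∀ n, a n ∈ D) ∧
      (∀ w ∈ F, ∀ i, ¬ occursAtN a i w ∧ ¬ occursAtN a i w.reverse) ∧ x = cf01 a }

/-- The Gauss–Cantor set of reals `[0; a₁, a₂, …]` whose partial quotients all lie in `D`
and whose digit sequence contains no word of `F` as a consecutive substring. -/
noncomputable def gaussCantor (D : Set ℕ) (F : List (List ℕ)) : Set ℝ :=
  { x | ∃ a : ℕ → ℕ, (∀ n, a n ∈ D) ∧ (∀ w ∈ F, ∀ i, ¬ occursAtN a i w) ∧ x = cf01 a }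

/-- The 25 forbidden words defining the Cantor set `Y`. -/
def forbiddenY : List (List ℕ) :=
  [[2, 1, 2, 1, 2],
   [2, 1, 1, 1, 2, 1, 2, 1],
   [2, 1, 1, 1, 2, 1, 2, 2, 2],
   [1, 1, 1, 1, 1, 2, 1, 2, 1],
   [1, 2, 1, 1, 1, 2, 1, 2],
   [1, 1, 1, 2, 1, 2, 1, 1, 1],
   [2, 1, 1, 1, 2, 1, 2, 2, 1, 1, 2],
   [2, 2, 2, 1, 1, 1, 2, 1, 2, 2, 1, 1],
   [1, 2, 2, 1, 1, 1, 1, 2, 1, 2, 1, 1, 2, 2],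
   [1, 1, 2, 2, 1, 1, 1, 2, 1, 2, 2, 1, 1, 1, 1],
   [2, 2, 1, 1, 1, 1, 2, 1, 2, 1, 1, 2, 2, 1],
   [2, 1, 1, 2, 2, 1, 1, 1, 2, 1, 2, 2, 1, 1],
   [2, 1, 1, 1, 2, 1, 2, 2, 1, 1, 1, 1, 2],
   [2, 2, 2, 2, 1, 1, 1, 1, 2, 1, 2, 1, 1, 2, 2, 2, 2],
   [2, 1, 1, 1, 1, 2, 2, 1, 1, 1, 2, 1, 2, 2, 1, 1, 1, 2, 2, 1],
   [2, 1, 2, 1, 1, 1, 1, 2, 2, 1, 1, 1, 2, 1, 2, 2, 1, 1, 1, 2, 2, 2, 2],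
   [2, 2, 1, 2, 2, 1, 1, 1, 2, 1, 2, 2, 1, 1, 1, 1, 1, 1, 2],
   [2, 1, 2, 2, 1, 2, 2, 1, 1, 1, 2, 1, 2, 2, 1, 1, 1, 1, 1, 1],
   [1, 2, 2, 1, 2, 2, 1, 1, 1, 2, 1, 2, 2, 1, 1, 1, 1, 1, 1, 1, 1],
   [1, 1, 1, 2, 2, 1, 2, 2, 1, 1, 1, 2, 1, 2, 2, 1, 1, 1, 1, 1, 1, 1, 2, 2],
   [2, 2, 2, 2, 1, 2, 2, 1, 1, 1, 2, 1, 2, 2, 1, 1, 1, 1, 1, 1, 1, 1, 2],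
   [2, 1, 2, 2, 2, 2, 1, 1, 1, 1, 2, 1, 2, 1, 1, 2, 2, 2, 1, 1, 2],
   [1, 1, 1, 2, 2, 2, 2, 1, 1, 1, 1, 2, 1, 2, 1, 1, 2, 2, 2, 1, 1, 2],
   [1, 2, 1, 2, 2, 2, 2, 1, 1, 1, 1, 2, 1, 2, 1, 1, 2, 2, 2, 1, 1, 1, 1],
   [2, 1, 2, 2, 2, 2, 1, 1, 1, 1, 2, 1, 2, 1, 1, 2, 2, 2, 1, 1, 1, 1, 2]]

/-! ### Convergence and the recursion for continued fractions -/

theorem cfNum_succ_eq (a : ℕ → ℕ) (n : ℕ) :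
    cfNum a (n + 1) = a 0 * cfNum (fun k => a (k + 1)) n + cfDen (fun k => a (k + 1)) n ∧
      cfDen a (n + 1) = cfNum (fun k => a (k + 1)) n := by
  induction n using Nat.strong_induction_on with
  | _ n ih =>
    match n with
    | 0 => simp [cfNum, cfDen, mul_comm]
    | 1 =>
      constructor <;> simp [cfNum, cfDen]
      ring
    | m + 2 =>
      obtain ⟨h1, h2⟩ := ih (m + 1) (by omega)
      obtain ⟨h3, h4⟩ := ih m (by omega)
      constructor
      · rw [cfNum, h1, h3, cfNum, cfDen]; ring
      · rw [cfDen, h2, h4, cfNum]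

theorem cfDen_pos {a : ℕ → ℕ} (ha : ∀ n, 1 ≤ a n) (n : ℕ) : 0 < cfDen a n := by
  induction n using Nat.strong_induction_on with
  | _ n ih =>
    match n with
    | 0 => simp [cfDen]
    | 1 => exact ha 1
    | m + 2 => rw [cfDen]; have := ih m (by omega); omega

theorem cfDen_le_succ {a : ℕ → ℕ} (ha : ∀ n, 1 ≤ a n) (n : ℕ) :
    cfDen a n ≤ cfDen a (n + 1) := by
  cases n with
  | zero => exact ha 1
  | succ n => rw [cfDen]; nlinarith [ha (n + 2), cfDen_pos ha (n + 1)]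

theorem two_pow_le_cfDen_mul {a : ℕ → ℕ} (ha : ∀ n, 1 ≤ a n) (n : ℕ) :
    2 ^ n ≤ cfDen a n * cfDen a (n + 1) := by
  induction n with
  | zero => simpa [cfDen] using ha 1
  | succ n ih =>
    have h1 := cfDen_le_succ ha n
    have h2 : cfDen a (n + 1) + cfDen a n ≤ cfDen a (n + 2) := by
      rw [cfDen]; nlinarith [ha (n + 2), cfDen_pos ha (n + 1)]
    rw [pow_succ]
    nlinarith [cfDen_pos ha (n + 1)]

theorem cfNum_mul_cfDen_sub (a : ℕ → ℕ) (n : ℕ) :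
    (cfNum a (n + 1) : ℝ) * cfDen a n - cfNum a n * cfDen a (n + 1) = (-1) ^ n := by
  induction n with
  | zero => simp [cfNum, cfDen]; ring
  | succ n ih =>
    rw [cfNum, cfDen, pow_succ, ← ih]
    push_cast
    ring

theorem tendsto_cfVal {a : ℕ → ℕ} (ha : ∀ n, 1 ≤ a n) :
    Tendsto (fun n => (cfNum a n : ℝ) / cfDen a n) atTop (nhds (cfVal a)) := by
  refine CauchySeq.tendsto_limUnder (cauchySeq_of_le_geometric (1 / 2) 1 (by norm_num) fun n => ?_)
  have h0 : (0 : ℝ) < cfDen a n := by exact_mod_cast cfDen_pos ha n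
  have h1 : (0 : ℝ) < cfDen a (n + 1) := by exact_mod_cast cfDen_pos ha (n + 1)
  have h2 : (2 : ℝ) ^ n ≤ cfDen a n * cfDen a (n + 1) := by
    exact_mod_cast two_pow_le_cfDen_mul ha n
  have h3 := cfNum_mul_cfDen_sub a n
  rw [dist_comm, Real.dist_eq, div_sub_div _ _ h1.ne' h0.ne', mul_comm (cfDen a (n + 1) : ℝ),
    mul_comm (cfDen a (n + 1) : ℝ), h3, abs_div, abs_pow, abs_neg, abs_one, one_pow,
    abs_of_pos (mul_pos h0 h1), one_mul, one_div_pow]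
  exact one_div_le_one_div_of_le (by positivity) h2

theorem one_le_cfVal {a : ℕ → ℕ} (ha : ∀ n, 1 ≤ a n) : 1 ≤ cfVal a := by
  refine ge_of_tendsto' ((tendsto_add_atTop_iff_nat 1).2 (tendsto_cfVal ha)) fun n => ?_
  have h1 : (0 : ℝ) < cfDen a (n + 1) := by exact_mod_cast cfDen_pos ha (n + 1)
  rw [le_div_iff₀ h1, one_mul]
  obtain ⟨h2, h3⟩ := cfNum_succ_eq a n
  rw [h2, h3]
  exact_mod_cast (Nat.le_mul_of_pos_left _ (ha 0)).trans (Nat.le_add_right _ _)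

theorem cfVal_eq {a : ℕ → ℕ} (ha : ∀ n, 1 ≤ a n) :
    cfVal a = a 0 + 1 / cfVal fun k => a (k + 1) := by
  have hb : ∀ n, 1 ≤ (fun k => a (k + 1)) n := fun n => ha (n + 1)
  have h1 := (tendsto_add_atTop_iff_nat 1).2 (tendsto_cfVal ha)
  have h2 := tendsto_cfVal hb
  have h3 := (h2.inv₀ (zero_lt_one.trans_le (one_le_cfVal hb)).ne').const_add (a 0 : ℝ)
  rw [one_div]
  refine tendsto_nhds_unique h1 (h3.congr fun n => ?_)
  obtain ⟨h4, h5⟩ := cfNum_succ_eq a n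
  have h6 : (0 : ℝ) < cfNum (fun k => a (k + 1)) n := by
    rw [← h5]; exact_mod_cast cfDen_pos ha (n + 1)
  rw [h4, h5, inv_div]
  push_cast
  field_simp

theorem cfVal_le_three {a : ℕ → ℕ} (ha : ∀ n, a n = 1 ∨ a n = 2) : cfVal a ≤ 3 := by
  have ha' : ∀ n, 1 ≤ a n := fun n => by have := ha n; omega
  have h := one_le_cfVal fun n => ha' (n + 1)
  rw [cfVal_eq ha']
  have h1 : (a 0 : ℝ) ≤ 2 := by exact_mod_cast (show a 0 ≤ 2 by have := ha 0; omega)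
  have h2 : 1 / cfVal (fun k => a (k + 1)) ≤ 1 := by
    rw [div_le_one (by linarith)]; exact h
  linarith

theorem cfVal_le_of_head_eq_one {a : ℕ → ℕ} (ha : ∀ n, a n = 1 ∨ a n = 2) (h0 : a 0 = 1) :
    cfVal a ≤ 7 / 4 := by
  have ha' : ∀ n, 1 ≤ a n := fun n => by have := ha n; omega
  have h := one_le_cfVal fun n => ha' (n + 1 + 1)
  have h3 := cfVal_le_three fun n => ha (n + 1 + 1)
  have h4 : 4 / 3 ≤ cfVal fun k => a (k + 1) := by
    rw [cfVal_eq fun n => ha' (n + 1)]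
    have h1 : (1 : ℝ) ≤ a (0 + 1) := by exact_mod_cast ha' 1
    have h2 : 1 / 3 ≤ 1 / cfVal (fun k => a (k + 1 + 1)) :=
      one_div_le_one_div_of_le (by linarith) h3
    linarith
  rw [cfVal_eq ha', h0]
  have h5 := one_div_le_one_div_of_le (by norm_num) h4
  norm_num at h5 ⊢
  linarith

theorem two_le_cfVal_of_head_eq_two {a : ℕ → ℕ} (ha : ∀ n, 1 ≤ a n) (h0 : a 0 = 2) :
    2 ≤ cfVal a := by
  have h := one_le_cfVal fun n => ha (n + 1)
  rw [cfVal_eq ha, h0]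
  have : 0 < 1 / cfVal (fun k => a (k + 1)) := by positivity
  norm_num at this ⊢
  linarith

theorem quarter_le_abs_cfVal_sub {a b : ℕ → ℕ} (ha : ∀ n, a n = 1 ∨ a n = 2)
    (hb : ∀ n, b n = 1 ∨ b n = 2) (h : a 0 ≠ b 0) : 1 / 4 ≤ |cfVal a - cfVal b| := by
  have ha' : ∀ n, 1 ≤ a n := fun n => by have := ha n; omega
  have hb' : ∀ n, 1 ≤ b n := fun n => by have := hb n; omega
  rcases ha 0 with h1 | h1 <;> rcases hb 0 with h2 | h2
  · omega
  · have := cfVal_le_of_head_eq_one ha h1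
    have := two_le_cfVal_of_head_eq_two hb' h2
    rw [abs_sub_comm]
    exact le_trans (by linarith) (le_abs_self _)
  · have := cfVal_le_of_head_eq_one hb h2
    have := two_le_cfVal_of_head_eq_two ha' h1
    exact le_trans (by linarith) (le_abs_self _)
  · omega

theorem abs_cfVal_sub_mul (n : ℕ) : ∀ (Q : ℕ → ℝ) (a b : ℕ → ℕ),
    (∀ k, 1 ≤ a k) → (∀ k, 1 ≤ b k) → (∀ k < n, a k = b k) →
      (∀ k < n, Q (k + 2) = a k * Q (k + 1) + Q k) →
      |cfVal a - cfVal b| *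
          ((Q (n + 1) * cfVal (fun k => a (k + n)) + Q n) *
            (Q (n + 1) * cfVal (fun k => b (k + n)) + Q n)) =
        |cfVal (fun k => a (k + n)) - cfVal (fun k => b (k + n))| *
          ((Q 1 * cfVal a + Q 0) * (Q 1 * cfVal b + Q 0)) := by
  induction n with
  | zero => intros; rfl
  | succ n ih =>
    intro Q a b ha hb hab hQ
    have key := ih (fun k => Q (k + 1)) (fun k => a (k + 1)) (fun k => b (k + 1))
      (fun k => ha _) (fun k => hb _) (fun k hk => hab _ (by omega))
      (fun k hk => hQ (k + 1) (by omega))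
    have hX := one_le_cfVal fun n => ha (n + 1)
    have hY := one_le_cfVal fun n => hb (n + 1)
    have hQ0 := hQ 0 (by omega)
    have hab0 := hab 0 (by omega)
    have hshift : ∀ c : ℕ → ℕ, (fun k => c (k + n + 1)) = fun k => c (k + (n + 1)) := fun c => rfl
    simp only [hshift] at key
    rw [cfVal_eq ha, cfVal_eq hb, ← hab0]
    simp only [zero_add] at hQ0 key
    rw [hQ0] at key
    set X := cfVal fun k => a (k + 1)
    set Y := cfVal fun k => b (k + 1)
    have hX0 : 0 < X := by linarith
    have hY0 : 0 < Y := by linarith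
    have hd : |(a 0 : ℝ) + 1 / X - (a 0 + 1 / Y)| = |X - Y| / (X * Y) := by
      rw [show (a 0 : ℝ) + 1 / X - (a 0 + 1 / Y) = (Y - X) / (X * Y) by field_simp; ring,
        abs_div, abs_of_pos (mul_pos hX0 hY0), abs_sub_comm]
    rw [hd, div_mul_eq_mul_div, key]
    field_simp
    ring

/-- If two digit sequences over `{1, 2}` share exactly their first `n` digits, the values are
separated in terms of any nonnegative solution `Q` of the continuant recursion. -/
theorem le_abs_cf01_sub (n : ℕ) (Q : ℕ → ℝ) (a b : ℕ → ℕ) (ha : ∀ k, a k = 1 ∨ a k = 2)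
    (hb : ∀ k, b k = 1 ∨ b k = 2) (hab : ∀ k < n, a k = b k) (hn : a n ≠ b n)
    (hQ : ∀ k < n, Q (k + 2) = a k * Q (k + 1) + Q k) (hQ0 : 0 ≤ Q 0) (hQ1 : Q 1 = 1)
    (hQn : 0 ≤ Q n) (hQn' : Q n ≤ Q (n + 1)) :
    1 ≤ 576 * (|cf01 a - cf01 b| * Q (n + 1) ^ 2) := by
  have ha' : ∀ n, 1 ≤ a n := fun n => by have := ha n; omega
  have hb' : ∀ n, 1 ≤ b n := fun n => by have := hb n; omega
  have key := abs_cfVal_sub_mul n Q a b ha' hb' hab hQ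
  have hd : 1 / 4 ≤ |cfVal (fun k => a (k + n)) - cfVal (fun k => b (k + n))| :=
    quarter_le_abs_cfVal_sub (fun k => ha _) (fun k => hb _) (by simpa using hn)
  have hX := one_le_cfVal ha'
  have hY := one_le_cfVal hb'
  have hX3 := cfVal_le_three ha
  have hY3 := cfVal_le_three hb
  have hXn := one_le_cfVal fun k => ha' (k + n)
  have hYn := one_le_cfVal fun k => hb' (k + n)
  have hXn3 := cfVal_le_three fun k => ha (k + n)
  have hYn3 := cfVal_le_three fun k => hb (k + n)
  have hcf : |cfVal a - cfVal b| ≤ 9 * |cf01 a - cf01 b| := by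
    rw [cf01, cf01, div_sub_div _ _ (by linarith) (by linarith), one_mul, mul_one, abs_div,
      abs_of_pos (mul_pos (zero_lt_one.trans_le hX) (zero_lt_one.trans_le hY)), abs_sub_comm,
      mul_div_assoc', le_div_iff₀ (by nlinarith), mul_comm]
    gcongr
    nlinarith
  have h1 : 1 ≤ (Q 1 * cfVal a + Q 0) * (Q 1 * cfVal b + Q 0) := by
    rw [hQ1]
    exact one_le_mul_of_one_le_of_one_le (by linarith) (by linarith)
  have h2 : (Q (n + 1) * cfVal (fun k => a (k + n)) + Q n) *
      (Q (n + 1) * cfVal (fun k => b (k + n)) + Q n) ≤ (4 * Q (n + 1)) * (4 * Q (n + 1)) := by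
    have hq : 0 ≤ Q (n + 1) := hQn.trans hQn'
    apply mul_le_mul <;> nlinarith
  have h3 : 1 / 4 * 1 ≤ |cfVal a - cfVal b| * ((4 * Q (n + 1)) * (4 * Q (n + 1))) := by
    calc 1 / 4 * 1 ≤ _ := mul_le_mul hd h1 zero_le_one (abs_nonneg _)
      _ = _ := key.symm
      _ ≤ _ := mul_le_mul_of_nonneg_left h2 (abs_nonneg _)
  have h4 : |cfVal a - cfVal b| * Q (n + 1) ^ 2 ≤ 9 * |cf01 a - cf01 b| * Q (n + 1) ^ 2 :=
    mul_le_mul_of_nonneg_right hcf (sq_nonneg _)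
  nlinarith

/-! ### A weighted automaton for the forbidden words -/

/-- A state of a finite automaton reading continued fraction digits in `{1, 2}`. The state
certifies that the ratio of the last two continuants lies in `[lo, hi] / 10 ^ 5`, its
successors are `next₁` and `next₂`, and its weight at continuants `q, p` is
`1 / (α * q + β * p)`. -/
structure CFState where
  α : ℕ
  β : ℕ
  lo : ℕ
  hi : ℕ
  next₁ : ℕ
  next₂ : ℕ

namespace CFState

/-- The automaton recognising the digit sequences avoiding `forbiddenY` and the reversed words.
The index `449` stands for the rejecting state. -/
def table : List CFState :=
  [⟨10158813, 5534211, 61789, 61810, 0, 268⟩, ⟨10159151, 5534455, 61789, 61795, 0, 269⟩,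
   ⟨15692826, 10159158, 61792, 61795, 0, 449⟩, ⟨10158297, 5533726, 61827, 61839, 1, 267⟩,
   ⟨10158766, 5534052, 61827, 61832, 1, 270⟩, ⟨28542257, 11334812, 61827, 61831, 449, 270⟩,
   ⟨52426227, 19958041, 61827, 61831, 449, 271⟩, ⟨13599081, 6756078, 61827, 61831, 2, 270⟩,
   ⟨10159166, 5534734, 61713, 61739, 3, 272⟩, ⟨10159506, 5534856, 61731, 61739, 4, 272⟩,
   ⟨15692812, 10158803, 61735, 61739, 4, 449⟩, ⟨39877346, 28541875, 61735, 61739, 5, 449⟩,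
   ⟨72390629, 52416043, 61735, 61739, 6, 449⟩, ⟨20355179, 13599081, 61735, 61739, 7, 449⟩,
   ⟨10158149, 5533210, 61976, 62036, 8, 266⟩, ⟨10158323, 5533342, 61976, 61989, 9, 266⟩,
   ⟨13597059, 6755718, 61976, 61980, 10, 266⟩, ⟨20168281, 8979571, 61976, 61980, 11, 266⟩,
   ⟨23249501, 9920111, 61976, 61980, 12, 266⟩, ⟨28535885, 11331215, 61976, 61980, 449, 266⟩,
   ⟨15540587, 7458332, 61976, 61980, 13, 266⟩, ⟨10000000, 5415831, 61199, 61350, 14, 273⟩,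
   ⟨10000069, 5416009, 61199, 61213, 14, 274⟩, ⟨27325463, 10815041, 61199, 61206, 449, 274⟩,
   ⟨36688470, 14221192, 61203, 61206, 449, 275⟩, ⟨48387722, 18367806, 61203, 61206, 449, 276⟩,
   ⟨36994992, 14331919, 61203, 61206, 449, 277⟩, ⟨37415205, 14483570, 61203, 61206, 449, 278⟩,
   ⟨38333678, 14814102, 61203, 61206, 449, 279⟩, ⟨40771088, 15686043, 61203, 61206, 449, 280⟩,
   ⟨10039529, 5445307, 61322, 61350, 15, 281⟩, ⟨10067607, 5466394, 61337, 61350, 15, 282⟩,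
   ⟨15691747, 10158215, 61341, 61344, 15, 449⟩, ⟨10610661, 5880731, 61341, 61344, 15, 283⟩,
   ⟨15691676, 10158330, 61346, 61350, 15, 449⟩, ⟨20352795, 13597062, 61346, 61350, 16, 449⟩,
   ⟨29147876, 20168290, 61346, 61350, 17, 449⟩, ⟨33169224, 23250189, 61346, 61350, 18, 449⟩,
   ⟨39867461, 28535361, 61346, 61350, 19, 449⟩, ⟨22999641, 15539449, 61346, 61350, 20, 449⟩,
   ⟨15703357, 10139283, 61323, 61327, 15, 449⟩, ⟨10051126, 5454035, 61325, 61329, 15, 284⟩,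
   ⟨10055540, 5457351, 61326, 61329, 15, 285⟩, ⟨10057195, 5458595, 61326, 61329, 15, 286⟩,
   ⟨10059788, 5460545, 61326, 61329, 15, 287⟩, ⟨10476944, 5820634, 63240, 63399, 21, 288⟩,
   ⟨12388736, 7363243, 63367, 63399, 22, 289⟩, ⟨38140531, 27325482, 63384, 63399, 23, 449⟩,
   ⟨50909698, 36688496, 63385, 63389, 24, 449⟩, ⟨66755575, 48387756, 63385, 63389, 25, 449⟩,
   ⟨51326952, 36995012, 63385, 63389, 26, 449⟩, ⟨51898809, 37415237, 63385, 63389, 27, 449⟩,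
   ⟨53147816, 38333708, 63385, 63389, 28, 449⟩, ⟨56457171, 40771117, 63385, 63389, 29, 449⟩,
   ⟨13944816, 8674331, 63369, 63373, 22, 290⟩, ⟨14705821, 9349066, 63369, 63372, 22, 291⟩,
   ⟨14783009, 9418724, 63369, 63372, 22, 292⟩, ⟨14933131, 9554969, 63369, 63372, 22, 293⟩,
   ⟨14999730, 9615734, 63369, 63372, 22, 294⟩, ⟨14872784, 9500086, 63369, 63372, 22, 295⟩,
   ⟨15095017, 9703027, 63369, 63372, 22, 296⟩, ⟨15416089, 10000076, 63369, 63372, 22, 449⟩,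
   ⟨14126559, 8833182, 63369, 63372, 22, 297⟩, ⟨13970806, 8696958, 63369, 63372, 22, 298⟩,
   ⟨15416089, 10000076, 63369, 63373, 22, 449⟩, ⟨15416089, 10000076, 63371, 63376, 22, 449⟩,
   ⟨10360098, 5710676, 63001, 63031, 31, 299⟩, ⟨10401051, 5742226, 63017, 63031, 31, 300⟩,
   ⟨10411994, 5750678, 63021, 63025, 31, 301⟩, ⟨10415182, 5753140, 63021, 63025, 31, 302⟩,
   ⟨14166883, 7123542, 63018, 63021, 32, 300⟩, ⟨10820952, 5905042, 63018, 63021, 33, 300⟩,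
   ⟨10439290, 5771769, 63026, 63031, 31, 303⟩, ⟨14090594, 7073901, 63002, 63006, 34, 299⟩,
   ⟨30807369, 12306062, 63002, 63006, 449, 299⟩, ⟨43388014, 16970927, 63002, 63006, 449, 304⟩,
   ⟨49216610, 19101223, 63002, 63006, 449, 305⟩, ⟨16188035, 7853143, 63002, 63006, 35, 299⟩,
   ⟨18999161, 8833987, 63002, 63006, 36, 299⟩, ⟨19962975, 9151627, 63002, 63006, 37, 299⟩,
   ⟨21275158, 9567480, 63002, 63006, 38, 299⟩, ⟨17158429, 8202258, 63002, 63006, 39, 299⟩,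
   ⟨10369724, 5718104, 63005, 63009, 31, 306⟩, ⟨10379377, 5725542, 63006, 63009, 31, 307⟩,
   ⟨10382072, 5727619, 63006, 63009, 31, 308⟩, ⟨10385353, 5730148, 63006, 63009, 31, 309⟩,
   ⟨10373408, 5720943, 63005, 63009, 31, 310⟩, ⟨10416074, 5762077, 63057, 63072, 30, 311⟩,
   ⟨14218725, 7196658, 63064, 63067, 40, 311⟩, ⟨31559166, 12539691, 63064, 63067, 449, 311⟩,
   ⟨10425382, 5765857, 63057, 63062, 41, 312⟩, ⟨10428860, 5767249, 63057, 63061, 42, 312⟩,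
   ⟨10430163, 5767772, 63057, 63060, 43, 312⟩, ⟨10432207, 5768590, 63057, 63060, 44, 312⟩,
   ⟨10177278, 5458110, 57733, 58126, 45, 313⟩, ⟨11417727, 5904629, 57733, 57807, 46, 313⟩,
   ⟨19088160, 8466749, 57733, 57765, 47, 313⟩, ⟨26890631, 10630355, 57751, 57758, 449, 313⟩,
   ⟨35896790, 13898480, 57754, 57758, 449, 314⟩, ⟨47020027, 17831888, 57754, 57758, 449, 315⟩,
   ⟨39796116, 15294157, 57754, 57758, 449, 316⟩, ⟨41507484, 15901337, 57754, 57758, 449, 317⟩,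
   ⟨42187358, 16141571, 57754, 57758, 449, 318⟩, ⟨43298117, 16532621, 57754, 57758, 449, 319⟩,
   ⟨20599494, 8932437, 57759, 57763, 48, 313⟩, ⟨21821526, 9290949, 57759, 57763, 49, 313⟩,
   ⟨20639095, 8944315, 57760, 57763, 50, 313⟩, ⟨20692573, 8960328, 57760, 57763, 51, 313⟩,
   ⟨20806286, 8994269, 57759, 57763, 52, 313⟩, ⟨21088518, 9077882, 57759, 57763, 53, 313⟩,
   ⟨12315405, 6213464, 57799, 57804, 54, 313⟩, ⟨12726689, 6349299, 57800, 57804, 55, 313⟩,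
   ⟨12767444, 6362574, 57800, 57804, 56, 313⟩, ⟨12846244, 6388134, 57800, 57804, 57, 313⟩,
   ⟨12881007, 6399366, 57800, 57804, 58, 313⟩, ⟨12814643, 6377899, 57800, 57804, 59, 313⟩,
   ⟨12930541, 6415321, 57800, 57804, 60, 313⟩, ⟨13095650, 6468120, 57800, 57804, 61, 313⟩,
   ⟨12415133, 6246755, 57801, 57804, 62, 313⟩, ⟨12329726, 6218258, 57801, 57804, 63, 313⟩,
   ⟨13095650, 6468122, 57799, 57803, 64, 313⟩, ⟨13095645, 6468130, 57792, 57797, 65, 313⟩,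
   ⟨10115819, 5447171, 58655, 58725, 66, 321⟩, ⟨10144338, 5457888, 58655, 58683, 67, 321⟩,
   ⟨10151957, 5460732, 58670, 58674, 68, 321⟩, ⟨10154175, 5461561, 58670, 58674, 69, 321⟩,
   ⟨16143289, 10401058, 58680, 58683, 67, 449⟩, ⟨21290509, 14166775, 58680, 58683, 70, 449⟩,
   ⟨16726332, 10820405, 58680, 58683, 71, 449⟩, ⟨10170919, 5467841, 58655, 58663, 72, 321⟩,
   ⟨21164509, 14090604, 58718, 58722, 73, 449⟩, ⟨43113461, 30807390, 58718, 58722, 74, 449⟩,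
   ⟨60358951, 43388099, 58718, 58722, 75, 449⟩, ⟨68317989, 49216462, 58718, 58722, 76, 449⟩,
   ⟨24041195, 16188046, 58718, 58722, 77, 449⟩, ⟨27833156, 18999192, 58718, 58722, 78, 449⟩,
   ⟨29114549, 19963115, 58718, 58722, 79, 449⟩, ⟨30842711, 21275087, 58718, 58722, 80, 449⟩,
   ⟨25360638, 17158554, 58718, 58722, 81, 449⟩, ⟨10122557, 5449656, 58709, 58715, 82, 321⟩,
   ⟨10129287, 5452178, 58709, 58713, 83, 321⟩, ⟨10131165, 5452881, 58710, 58713, 84, 321⟩,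
   ⟨27038469, 10779669, 58710, 58713, 449, 321⟩, ⟨10133451, 5453738, 58709, 58713, 85, 321⟩,
   ⟨10125127, 5450618, 58711, 58714, 86, 321⟩, ⟨10146891, 5453475, 58552, 58585, 87, 320⟩,
   ⟨10147261, 5453762, 58560, 58564, 87, 322⟩, ⟨10147767, 5454135, 58561, 58564, 87, 323⟩,
   ⟨10148835, 5454919, 58563, 58567, 87, 324⟩, ⟨16175662, 10420350, 58563, 58567, 87, 449⟩,
   ⟨21412375, 14223897, 58563, 58567, 88, 449⟩, ⟨44136622, 31494759, 58563, 58567, 89, 449⟩,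
   ⟨10156600, 5459375, 58576, 58585, 90, 325⟩, ⟨10158518, 5460329, 58580, 58583, 91, 325⟩,
   ⟨27016550, 10719109, 58580, 58583, 449, 325⟩, ⟨10159238, 5460686, 58581, 58585, 92, 325⟩,
   ⟨10160364, 5461247, 58581, 58585, 93, 325⟩, ⟨11356235, 6475628, 72044, 73207, 94, 326⟩,
   ⟨11652094, 6715686, 72313, 72484, 94, 327⟩, ⟨12517961, 7437060, 72352, 72380, 94, 328⟩,
   ⟨11855503, 6881984, 72322, 72328, 94, 329⟩, ⟨12003978, 7004580, 72323, 72328, 94, 330⟩,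
   ⟨15614490, 10206193, 72324, 72327, 94, 449⟩, ⟨11916537, 6932245, 72322, 72326, 94, 331⟩,
   ⟨11939876, 6951515, 72322, 72326, 94, 332⟩, ⟨11948647, 6958763, 72322, 72326, 94, 333⟩,
   ⟨11962408, 6970144, 72322, 72326, 94, 334⟩, ⟨14290332, 8946272, 72450, 72484, 94, 335⟩,
   ⟨15635398, 10177285, 72468, 72484, 94, 449⟩, ⟨14593115, 9216562, 72451, 72456, 94, 336⟩,
   ⟨14675794, 9291075, 72452, 72455, 94, 337⟩, ⟨14700017, 9312967, 72452, 72455, 94, 338⟩,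
   ⟨14885266, 9481292, 72452, 72456, 94, 339⟩, ⟨14360652, 9008677, 72451, 72454, 94, 340⟩,
   ⟨14431681, 9071932, 72451, 72454, 94, 341⟩, ⟨14451610, 9089721, 72451, 72454, 94, 342⟩,
   ⟨14475933, 9111459, 72451, 72454, 94, 343⟩, ⟨14387700, 9032737, 72451, 72454, 94, 344⟩,
   ⟨14885267, 9481291, 72454, 72459, 94, 345⟩, ⟨11429073, 6535119, 72108, 72125, 94, 346⟩,
   ⟨11481502, 6577451, 72116, 72125, 94, 347⟩, ⟨11430856, 6536567, 72109, 72113, 94, 348⟩,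
   ⟨11433261, 6538506, 72109, 72113, 94, 349⟩, ⟨11438336, 6542599, 72109, 72113, 94, 350⟩,
   ⟨11450717, 6552588, 72110, 72114, 94, 351⟩, ⟨17322368, 11417735, 72992, 73207, 95, 449⟩,
   ⟨27554929, 19088174, 73120, 73207, 96, 449⟩, ⟨37521013, 26890650, 73139, 73155, 97, 449⟩,
   ⟨49795305, 35896815, 73140, 73144, 98, 449⟩, ⟨64851961, 47020061, 73140, 73144, 99, 449⟩,
   ⟨55090311, 39796144, 73140, 73143, 100, 449⟩, ⟨57408851, 41507527, 73140, 73143, 101, 449⟩,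
   ⟨58328973, 42187383, 73140, 73143, 102, 449⟩, ⟨59830801, 43298118, 73140, 73143, 103, 449⟩,
   ⟨29531951, 20599508, 73124, 73129, 104, 449⟩, ⟨31112497, 21821542, 73125, 73129, 105, 449⟩,
   ⟨29583430, 20639109, 73124, 73128, 106, 449⟩, ⟨29652921, 20692589, 73124, 73128, 107, 449⟩,
   ⟨29800576, 20806300, 73124, 73128, 108, 449⟩, ⟨30166422, 21088533, 73125, 73128, 109, 449⟩,
   ⟨18528883, 12315414, 73001, 73010, 110, 449⟩, ⟨19076002, 12726698, 73002, 73007, 111, 449⟩,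
   ⟨19130031, 12767453, 73003, 73006, 112, 449⟩, ⟨19234391, 12846253, 73003, 73006, 113, 449⟩,
   ⟨19280387, 12881017, 73003, 73006, 114, 449⟩, ⟨19192556, 12814651, 73003, 73006, 115, 449⟩,
   ⟨19345875, 12930550, 73003, 73006, 116, 449⟩, ⟨19563785, 13095660, 73003, 73007, 117, 449⟩,
   ⟨18661901, 12415141, 73002, 73005, 118, 449⟩, ⟨18547997, 12329735, 73001, 73005, 119, 449⟩,
   ⟨19563785, 13095659, 73006, 73010, 120, 449⟩, ⟨19563789, 13095654, 73022, 73032, 121, 449⟩,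
   ⟨10828684, 6062754, 70409, 70441, 123, 352⟩, ⟨10871989, 6096537, 70427, 70441, 123, 353⟩,
   ⟨10876146, 6099791, 70429, 70434, 123, 354⟩, ⟨10884121, 6106028, 70430, 70433, 123, 355⟩,
   ⟨10887613, 6108759, 70430, 70433, 123, 356⟩, ⟨10880933, 6103535, 70429, 70433, 123, 357⟩,
   ⟨10892560, 6112628, 70430, 70434, 123, 358⟩, ⟨10913936, 6128139, 70435, 70441, 124, 359⟩,
   ⟨10915428, 6128951, 70437, 70441, 125, 359⟩, ⟨15134578, 7699562, 70410, 70413, 126, 352⟩,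
   ⟨34979776, 14093243, 70410, 70413, 449, 352⟩, ⟨39501049, 15818622, 70410, 70413, 449, 360⟩,
   ⟨52474982, 20694821, 70410, 70413, 449, 361⟩, ⟨61247175, 23955199, 70410, 70413, 449, 362⟩,
   ⟨46389680, 18422751, 70410, 70413, 449, 363⟩, ⟨80217623, 30844294, 70410, 70413, 449, 364⟩,
   ⟨17654930, 8666595, 70410, 70413, 127, 352⟩, ⟨15454186, 7825704, 70410, 70413, 128, 352⟩,
   ⟨10839404, 6071129, 70414, 70418, 123, 365⟩, ⟨10830225, 6063973, 70414, 70417, 123, 366⟩,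
   ⟨10926591, 6134943, 70469, 70486, 129, 367⟩, ⟨10706388, 5972398, 70290, 70328, 122, 368⟩,
   ⟨17330749, 8477780, 70298, 70302, 130, 368⟩, ⟨23289939, 10527215, 70298, 70302, 131, 368⟩,
   ⟨25597155, 11274731, 70298, 70302, 132, 368⟩, ⟨26355890, 11511046, 70298, 70302, 133, 368⟩,
   ⟨33911039, 13638454, 70298, 70302, 449, 368⟩, ⟨18447255, 8888182, 70298, 70302, 134, 368⟩,
   ⟨19716090, 9339164, 70298, 70302, 135, 368⟩, ⟨20101336, 9472779, 70298, 70302, 136, 368⟩,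
   ⟨20590804, 9640219, 70298, 70302, 137, 368⟩, ⟨18912240, 9055470, 70298, 70302, 138, 368⟩,
   ⟨33911040, 13638453, 70298, 70302, 449, 368⟩, ⟨10710771, 5974744, 70318, 70328, 139, 368⟩,
   ⟨10715153, 5977099, 70322, 70328, 140, 368⟩, ⟨10716375, 5977757, 70323, 70327, 141, 368⟩,
   ⟨15583811, 10131522, 70323, 70327, 141, 449⟩, ⟨37695345, 27213134, 70323, 70327, 142, 449⟩,
   ⟨10717864, 5978555, 70324, 70328, 143, 368⟩, ⟨10712442, 5975647, 70319, 70323, 144, 368⟩,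
   ⟨10907649, 6125710, 70696, 70785, 145, 369⟩, ⟨10907984, 6125819, 70756, 70761, 146, 369⟩,
   ⟨10908410, 6125998, 70756, 70760, 147, 369⟩, ⟨10909306, 6126383, 70748, 70754, 148, 369⟩,
   ⟨15307051, 7812005, 70748, 70751, 149, 369⟩, ⟨17915098, 8818162, 70748, 70751, 150, 369⟩,
   ⟨24360841, 11061380, 70748, 70751, 151, 369⟩, ⟨10915400, 6129348, 70696, 70715, 152, 370⟩,
   ⟨10916800, 6130045, 70700, 70704, 153, 370⟩, ⟨12508652, 7426441, 70701, 70704, 153, 371⟩,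
   ⟨15638150, 10131241, 70701, 70704, 153, 449⟩, ⟨37717667, 27042055, 70701, 70704, 154, 449⟩,
   ⟨10917322, 6130309, 70696, 70701, 155, 370⟩, ⟨10918145, 6130716, 70696, 70701, 156, 370⟩,
   ⟨11332341, 5870480, 38161, 38211, 159, 373⟩, ⟨11333561, 5871285, 38190, 38211, 159, 374⟩,
   ⟨11335878, 5872880, 38194, 38200, 159, 375⟩, ⟨11336893, 5873573, 38196, 38200, 159, 376⟩,
   ⟨11334948, 5872253, 38191, 38195, 159, 377⟩, ⟨19955026, 12517994, 38191, 38195, 159, 449⟩,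
   ⟨11338336, 5874540, 38205, 38211, 159, 378⟩, ⟨10814675, 5695153, 38261, 38287, 158, 379⟩,
   ⟨10815033, 5695377, 38281, 38287, 158, 380⟩, ⟨14221182, 8246081, 38282, 38286, 158, 381⟩,
   ⟨18367793, 11652103, 38282, 38286, 158, 449⟩, ⟨14331916, 8331130, 38282, 38286, 158, 382⟩,
   ⟨14483520, 8448163, 38282, 38286, 158, 383⟩, ⟨14814087, 8705478, 38282, 38286, 158, 384⟩,
   ⟨15686033, 9398993, 38282, 38286, 158, 385⟩, ⟨10941428, 5739725, 38261, 38269, 160, 379⟩,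
   ⟨11033045, 5771669, 38261, 38266, 161, 379⟩, ⟨13028368, 6405938, 38262, 38266, 162, 379⟩,
   ⟨10979179, 5752913, 38264, 38268, 163, 379⟩, ⟨10993581, 5757934, 38264, 38268, 164, 379⟩,
   ⟨10998989, 5759818, 38264, 38268, 165, 379⟩, ⟨11007469, 5762771, 38264, 38268, 166, 379⟩,
   ⟨12986424, 6409809, 37964, 37990, 168, 372⟩, ⟨26075402, 10288777, 37964, 37971, 449, 372⟩,
   ⟨60802946, 22834173, 37967, 37971, 449, 386⟩, ⟨133126001, 49073089, 37968, 37971, 449, 387⟩,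
   ⟨150140606, 55319748, 37968, 37971, 449, 388⟩, ⟨198814874, 73169891, 37968, 37971, 449, 389⟩,
   ⟨231652366, 85202191, 37968, 37971, 449, 390⟩, ⟨176014630, 64812944, 37968, 37971, 449, 391⟩,
   ⟨302341869, 111062117, 37968, 37971, 449, 392⟩, ⟨70298079, 26321558, 37968, 37971, 449, 393⟩,
   ⟨62014022, 23280000, 37968, 37971, 449, 394⟩, ⟨12306054, 6195239, 38017, 38024, 167, 395⟩,
   ⟨12464469, 6246463, 38017, 38022, 169, 395⟩, ⟨12507286, 6260201, 38018, 38021, 170, 395⟩,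
   ⟨12519795, 6264206, 38018, 38021, 171, 395⟩, ⟨12614947, 6294544, 38017, 38021, 172, 395⟩,
   ⟨16970834, 9446364, 38020, 38024, 167, 396⟩, ⟨19102386, 11011062, 38020, 38024, 167, 397⟩,
   ⟨12343072, 6207262, 38020, 38024, 173, 395⟩, ⟨12380322, 6219329, 38020, 38024, 174, 395⟩,
   ⟨12390748, 6222700, 38020, 38024, 175, 395⟩, ⟨12403459, 6226806, 38020, 38024, 176, 395⟩,
   ⟨12357273, 6211866, 38020, 38024, 177, 395⟩, ⟨12611047, 6292043, 38011, 38016, 178, 372⟩,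
   ⟨12611610, 6292408, 38012, 38016, 178, 398⟩, ⟨10630347, 5629918, 38650, 38801, 157, 399⟩,
   ⟨13898470, 8099823, 38795, 38798, 157, 400⟩, ⟨17831876, 11356243, 38795, 38798, 157, 449⟩,
   ⟨15294147, 9207794, 38795, 38798, 157, 401⟩, ⟨15901346, 9704750, 38795, 38798, 157, 402⟩,
   ⟨16141539, 9904261, 38795, 38798, 157, 403⟩, ⟨16532621, 10232837, 38795, 38798, 157, 404⟩,
   ⟨10677059, 5646548, 38650, 38678, 179, 399⟩, ⟨10710364, 5658406, 38650, 38663, 180, 399⟩,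
   ⟨10678205, 5646931, 38674, 38677, 181, 399⟩, ⟨10679735, 5647476, 38674, 38677, 182, 399⟩,
   ⟨10682963, 5648625, 38673, 38677, 183, 399⟩, ⟨10690831, 5651430, 38671, 38675, 184, 399⟩,
   ⟨16661804, 7649159, 36601, 36760, 186, 405⟩, ⟨18478612, 8203341, 36698, 36724, 187, 405⟩,
   ⟨25887614, 10210005, 36712, 36719, 449, 405⟩, ⟨19893043, 8632878, 36719, 36723, 188, 405⟩,
   ⟨21033163, 8961607, 36719, 36723, 189, 405⟩, ⟨20349819, 8766507, 36719, 36723, 190, 405⟩,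
   ⟨20528792, 8818167, 36719, 36723, 191, 405⟩, ⟨20596682, 8837659, 36719, 36723, 192, 405⟩,
   ⟨20703913, 8868329, 36719, 36723, 193, 405⟩, ⟨68947904, 25808565, 36698, 36706, 449, 406⟩,
   ⟨90924376, 33817202, 36702, 36705, 449, 407⟩, ⟨99341070, 36871939, 36702, 36705, 449, 408⟩,
   ⟨102089905, 37866991, 36702, 36705, 449, 409⟩, ⟨129010209, 47549560, 36702, 36705, 449, 410⟩,
   ⟨73118233, 27335477, 36702, 36705, 449, 411⟩, ⟨77826709, 29055296, 36702, 36705, 449, 412⟩,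
   ⟨79249679, 29574155, 36702, 36705, 449, 413⟩, ⟨81052966, 30231064, 36702, 36705, 449, 414⟩,
   ⟨74847765, 27967749, 36702, 36705, 449, 415⟩, ⟨129010209, 47549560, 36701, 36705, 449, 416⟩,
   ⟨17085633, 7782581, 36746, 36752, 194, 405⟩, ⟨17398889, 7879569, 36746, 36751, 195, 405⟩,
   ⟨17096177, 7785868, 36748, 36752, 196, 405⟩, ⟨17110372, 7790293, 36748, 36752, 197, 405⟩,
   ⟨17140392, 7799641, 36748, 36752, 198, 405⟩, ⟨17213949, 7822487, 36748, 36751, 199, 405⟩,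
   ⟨14093234, 6793282, 36975, 36983, 200, 419⟩, ⟨14289617, 6860980, 36975, 36980, 201, 419⟩,
   ⟨14308685, 6867519, 36976, 36980, 202, 419⟩, ⟨14345354, 6880076, 36976, 36980, 203, 419⟩,
   ⟨14361448, 6885580, 36976, 36980, 204, 419⟩, ⟨14330679, 6875053, 36976, 36980, 205, 419⟩,
   ⟨14384293, 6893385, 36976, 36980, 206, 419⟩, ⟨14459718, 6919092, 36975, 36979, 207, 419⟩,
   ⟨15818615, 7863789, 36979, 36982, 200, 420⟩, ⟨20694688, 11085653, 36979, 36982, 200, 421⟩,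
   ⟨23955087, 13337025, 36979, 36982, 200, 422⟩, ⟨18423327, 9542578, 36979, 36982, 200, 423⟩,
   ⟨30844336, 18528850, 36979, 36982, 200, 449⟩, ⟨14141535, 6809991, 36978, 36982, 208, 419⟩,
   ⟨14100198, 6795691, 36978, 36982, 209, 419⟩, ⟨14459180, 6918789, 36969, 36974, 210, 418⟩,
   ⟨13638444, 6634129, 36991, 36999, 185, 424⟩, ⟨14457237, 6917735, 36928, 36943, 211, 417⟩,
   ⟨14457972, 6918155, 36938, 36943, 211, 425⟩, ⟨25898863, 10205487, 36939, 36943, 449, 425⟩,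
   ⟨10288770, 5497844, 41965, 42025, 212, 426⟩, ⟨10317285, 5508330, 41965, 41990, 213, 427⟩,
   ⟨10320018, 5509320, 41978, 41985, 214, 427⟩, ⟨10325254, 5511230, 41980, 41984, 215, 427⟩,
   ⟨10327544, 5512067, 41980, 41984, 216, 427⟩, ⟨10323162, 5510465, 41981, 41985, 217, 427⟩,
   ⟨10330788, 5513254, 41978, 41982, 218, 427⟩, ⟨10344432, 5518503, 41965, 41972, 219, 428⟩,
   ⟨10345279, 5518879, 41965, 41969, 220, 428⟩, ⟨26204896, 10342782, 41965, 41968, 449, 428⟩,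
   ⟨27143891, 10686832, 41965, 41968, 449, 429⟩, ⟨28516759, 11189115, 41965, 41968, 449, 430⟩,
   ⟨31921861, 12420550, 41965, 41968, 449, 431⟩, ⟨44977274, 17034474, 41965, 41968, 449, 432⟩,
   ⟨22834157, 15134589, 42020, 42024, 221, 449⟩, ⟨49073054, 34979799, 42020, 42024, 222, 449⟩,
   ⟨55319713, 39501072, 42020, 42024, 223, 449⟩, ⟨73169828, 52475082, 42020, 42024, 224, 449⟩,
   ⟨85202511, 61247036, 42020, 42024, 225, 449⟩, ⟨64812903, 46388698, 42020, 42024, 226, 449⟩,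
   ⟨111062021, 80217619, 42020, 42024, 227, 449⟩, ⟨26321540, 17654949, 42020, 42024, 228, 449⟩,
   ⟨23279992, 15453991, 42020, 42024, 229, 449⟩, ⟨10295843, 5500394, 42011, 42015, 230, 426⟩,
   ⟨26203774, 10342754, 42011, 42015, 449, 426⟩, ⟨44974899, 17032270, 42011, 42015, 449, 433⟩,
   ⟨10289805, 5498182, 42012, 42016, 231, 426⟩, ⟨10351592, 5521852, 41874, 41904, 232, 434⟩,
   ⟨26205270, 10342969, 41875, 41878, 449, 434⟩, ⟨44980751, 17035705, 41875, 41878, 449, 435⟩,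
   ⟨61545328, 23118899, 41875, 41878, 449, 436⟩, ⟨71381180, 26734582, 41875, 41878, 449, 437⟩,
   ⟨95205111, 35423003, 41875, 41878, 449, 438⟩, ⟨10209998, 5467600, 42235, 42267, 233, 440⟩,
   ⟨25808547, 17330761, 42245, 42249, 234, 449⟩, ⟨33817178, 23289956, 42245, 42249, 235, 449⟩,
   ⟨36871912, 25597175, 42245, 42249, 236, 449⟩, ⟨37866977, 26355875, 42245, 42249, 237, 449⟩,
   ⟨47549527, 33911063, 42245, 42249, 238, 449⟩, ⟨27335457, 18447267, 42245, 42249, 239, 449⟩,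
   ⟨29055276, 19716102, 42245, 42249, 240, 449⟩, ⟨29574134, 20101356, 42245, 42249, 241, 449⟩,
   ⟨30231042, 20590824, 42245, 42249, 242, 449⟩, ⟨27967705, 18912311, 42245, 42249, 243, 449⟩,
   ⟨47549527, 33911064, 42245, 42249, 244, 449⟩, ⟨10212409, 5468758, 42193, 42208, 245, 439⟩,
   ⟨10214927, 5469883, 42193, 42201, 246, 439⟩, ⟨10215631, 5470193, 42196, 42200, 247, 439⟩,
   ⟨12996329, 6414658, 42196, 42199, 248, 439⟩, ⟨26204754, 10341246, 42196, 42199, 449, 439⟩,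
   ⟨44972481, 17038006, 42196, 42199, 449, 441⟩, ⟨18674320, 8305827, 42196, 42199, 249, 439⟩,
   ⟨10216485, 5470578, 42193, 42197, 250, 439⟩, ⟨10213375, 5469177, 42203, 42207, 251, 439⟩,
   ⟨10342384, 5519141, 41317, 41330, 252, 443⟩, ⟨10342550, 5519223, 41323, 41330, 253, 443⟩,
   ⟨10342774, 5519330, 41326, 41330, 254, 443⟩, ⟨10686959, 5769898, 41326, 41330, 254, 444⟩,
   ⟨11187069, 6143457, 41326, 41330, 254, 445⟩, ⟨12420423, 7081042, 41326, 41330, 254, 446⟩,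
   ⟨17034384, 10908508, 41326, 41330, 254, 449⟩, ⟨17037508, 10897645, 41318, 41322, 252, 449⟩,
   ⟨10342961, 5519328, 41337, 41345, 255, 442⟩, ⟨17035706, 10909302, 41342, 41345, 255, 449⟩,
   ⟨23119369, 15306342, 41342, 41345, 256, 449⟩, ⟨26735571, 17909565, 41342, 41345, 257, 449⟩,
   ⟨35422041, 24361354, 41342, 41345, 258, 449⟩, ⟨10342465, 5519288, 41275, 41291, 252, 447⟩,
   ⟨10342636, 5519415, 41275, 41284, 252, 448⟩, ⟨17029361, 10917369, 41287, 41290, 252, 449⟩,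
   ⟨10346362, 5520716, 41415, 41448, 259, 442⟩, ⟨10347139, 5521058, 41436, 41441, 260, 442⟩,
   ⟨11340364, 5874391, 41436, 41439, 261, 442⟩, ⟨13007063, 6439349, 41436, 41439, 262, 442⟩,
   ⟨18673684, 8296074, 41436, 41439, 263, 442⟩, ⟨10347433, 5521178, 41442, 41448, 264, 442⟩,
   ⟨10347887, 5521385, 41444, 41448, 265, 442⟩]

/-- The state with index `i`; out-of-range indices give a rejecting state of weight `0`. -/
def get (i : ℕ) : CFState := table.getD i ⟨0, 0, 0, 0, 0, 0⟩

/-- The index of the state reached from `r` by reading the digit `d`. -/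
def next (r : CFState) (d : ℕ) : ℕ := if d = 1 then r.next₁ else r.next₂

/-- The reciprocal weight. -/
def form (r : CFState) (q p : ℕ) : ℕ := r.α * q + r.β * p

/-- The reciprocal weight at real continuants. -/
noncomputable def formReal (r : CFState) (q p : ℝ) : ℝ := r.α * q + r.β * p

/-- The reciprocal weight at an endpoint `x` of the ratio interval, rescaled. -/
def endForm (r : CFState) (x : ℕ) : ℕ := r.form 100000 x

/-- The reciprocal weight of the successor `c`, reached by the digit `d`, at the endpoint `x`. -/
def childForm (c : CFState) (d x : ℕ) : ℕ := c.form (d * 100000 + x) 100000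

/-- The ratio interval of `r` is mapped into the one of its successor `c` by the digit `d`. -/
def RatioOk (r c : CFState) (d : ℕ) : Prop :=
  c.lo * (d * 100000 + r.hi) ≤ 100000 * 100000 ∧ 100000 * 100000 ≤ c.hi * (d * 100000 + r.lo)

instance (r c : CFState) (d : ℕ) : Decidable (RatioOk r c d) := by
  unfold RatioOk; infer_instance

/-- The weight grows by a definite factor when passing to the only successor. -/
def GainOne (r c : CFState) (d : ℕ) : Prop :=
  10000003 * c.childForm d r.lo ≤ 10000000 * r.endForm r.lo ∧
    10000003 * c.childForm d r.hi ≤ 10000000 * r.endForm r.hi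

instance (r c : CFState) (d : ℕ) : Decidable (GainOne r c d) := by
  unfold GainOne; infer_instance

/-- The weight grows by a definite factor when passing to the two successors. -/
def GainTwo (r b c : CFState) : Prop :=
  10000003 * (b.childForm 1 r.lo * c.childForm 2 r.lo) ≤
      10000000 * (r.endForm r.lo * (b.childForm 1 r.lo + c.childForm 2 r.lo)) ∧
    10000003 * (b.childForm 1 r.hi * c.childForm 2 r.hi) ≤
      10000000 * (r.endForm r.hi * (b.childForm 1 r.hi + c.childForm 2 r.hi)) ∧
    10000003 * (b.childForm 1 r.lo * c.childForm 2 r.hi +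
        b.childForm 1 r.hi * c.childForm 2 r.lo) ≤
      10000000 * (r.endForm r.lo * (b.childForm 1 r.hi + c.childForm 2 r.hi) +
        r.endForm r.hi * (b.childForm 1 r.lo + c.childForm 2 r.lo))

instance (r b c : CFState) : Decidable (GainTwo r b c) := by
  unfold GainTwo; infer_instance

/-- All the conditions on the row `r` of the table, given its successors `b` and `c`. -/
def OkWith (r b c : CFState) : Prop :=
  0 < r.α ∧ r.lo < r.hi ∧ (0 < b.α → r.RatioOk b 1) ∧ (0 < c.α → r.RatioOk c 2) ∧
    (0 < b.α ∨ 0 < c.α) ∧ (b.α = 0 → r.GainOne c 2) ∧ (c.α = 0 → r.GainOne b 1) ∧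
    (0 < b.α → 0 < c.α → r.GainTwo b c)

instance (r b c : CFState) : Decidable (OkWith r b c) := by
  unfold OkWith; infer_instance

theorem okWith_of_mem : ∀ r ∈ table, r.OkWith (get r.next₁) (get r.next₂) := by
  decide +kernel

theorem length_table : table.length = 449 := by decide +kernel

/-- Evaluates `k` at `n`, normalising `n` first under lazy reduction. -/
def force (n : ℕ) (k : ℕ → Bool) : Bool :=
  match n with
  | 0 => k 0
  | m + 1 => k (m + 1)

theorem force_eq (n : ℕ) (k : ℕ → Bool) : force n k = k n := by cases n <;> rfl

/-- The indices of the states reached by the digit `d` from states with index in `[l, r)`. -/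
def successors (d l r : ℕ) : List ℕ :=
  (((table.drop l).take (r - l)).map (next · d)).filter (· < 449)

/-- A lower bound for the elements of a list of naturals below `449`. -/
def lower (s : List ℕ) : ℕ := s.foldr (fun x m => x - (x - m)) 449

/-- A strict upper bound for the elements of a list of naturals. -/
def upper (s : List ℕ) : ℕ := s.foldr (fun x m => (x + 1) + (m - (x + 1))) 0

theorem lower_le {s : List ℕ} {x : ℕ} (h : x ∈ s) : lower s ≤ x := by
  induction s with
  | nil => simp at h
  | cons y s ih =>
    rw [lower, List.foldr_cons, ← lower]
    rcases List.mem_cons.1 h with rfl | h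
    · omega
    · have := ih h; omega

theorem lt_upper {s : List ℕ} {x : ℕ} (h : x ∈ s) : x < upper s := by
  induction s with
  | nil => simp at h
  | cons y s ih =>
    rw [upper, List.foldr_cons, ← upper]
    rcases List.mem_cons.1 h with rfl | h
    · omega
    · have := ih h; omega

/-- Checks that the word `w` is rejected when started from a state with index in `[l, r)`. -/
def rejects : List ℕ → ℕ → ℕ → Bool
  | [], l, r => Nat.ble r l
  | d :: w, l, r =>
    force (lower (successors d l r)) fun l' =>
      force (upper (successors d l r)) fun r' => rejects w l' r'

theorem rejects_of_mem :
    ∀ w ∈ forbiddenY, rejects w 0 449 = true ∧ rejects w.reverse 0 449 = true := by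
  decide +kernel

theorem get_mem_table {i : ℕ} (h : i < 449) : get i ∈ table := by
  have h' : i < table.length := by rwa [length_table]
  rw [get, List.getD_eq_getElem _ _ h']
  exact List.getElem_mem h'

theorem get_eq_of_le {i : ℕ} (h : 449 ≤ i) : get i = ⟨0, 0, 0, 0, 0, 0⟩ := by
  rw [get, List.getD_eq_default]
  rwa [length_table]

theorem okWith_get {i : ℕ} (h : i < 449) :
    (get i).OkWith (get ((get i).next 1)) (get ((get i).next 2)) :=
  okWith_of_mem _ (get_mem_table h)

theorem α_pos_iff {i : ℕ} : 0 < (get i).α ↔ i < 449 := by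
  constructor
  · intro h
    by_contra! h'
    simp [get_eq_of_le h'] at h
  · exact fun h => (okWith_get h).1

theorem next_mem_successors {i l r d : ℕ} (hi : i < 449) (hl : l ≤ i) (hr : i < r)
    (hn : (get i).next d < 449) : (get i).next d ∈ successors d l r := by
  have hi' : i < table.length := by rwa [length_table]
  refine List.mem_filter.2 ⟨List.mem_map.2 ⟨get i, ?_, rfl⟩, by simpa using hn⟩
  rw [get, List.getD_eq_getElem _ _ hi', List.mem_iff_getElem]
  refine ⟨i - l, ?_, ?_⟩
  · simp only [List.length_take, List.length_drop]
    omega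
  · simp only [List.getElem_take, List.getElem_drop]
    congr 1
    omega

theorem not_occursAtN_of_rejects {a idx : ℕ → ℕ} (hidx : ∀ k, idx k < 449)
    (hstep : ∀ k, idx (k + 1) = (get (idx k)).next (a k)) :
    ∀ (w : List ℕ) (l r i : ℕ), rejects w l r = true → l ≤ idx i → idx i < r →
      ¬ occursAtN a i w := by
  intro w
  induction w with
  | nil =>
    intro l r i h hl hr
    have := Nat.le_of_ble_eq_true h
    omega
  | cons d w ih =>
    intro l r i h hl hr hocc
    rw [rejects, force_eq, force_eq] at h
    have hd : a i = d := by simpa using hocc 0 (by simp)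
    have hmem := next_mem_successors (hidx i) hl hr
      (d := d) (by rw [← hd, ← hstep]; exact hidx _)
    rw [← hd, ← hstep] at hmem
    rw [← hd] at h
    refine ih _ _ (i + 1) h (lower_le hmem) (lt_upper hmem) fun j hj => ?_
    have := hocc (j + 1) (by simpa using hj)
    rw [List.getD_cons_succ] at this
    rw [← this]
    congr 1
    omega

theorem inv_gain_one {S L B y z a₀ a₁ b₀ b₁ κ : ℝ} (hy : 0 ≤ y) (hz : 0 ≤ z) (hL : 0 < L)
    (hB : 0 < B) (hS : 0 < S) (hLS : S * L = a₁ * y + a₀ * z) (hBS : S * B = b₁ * y + b₀ * z)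
    (h₀ : κ * b₀ ≤ a₀) (h₁ : κ * b₁ ≤ a₁) : κ * L⁻¹ ≤ B⁻¹ := by
  have h : S * (κ * B) ≤ S * L := by
    rw [hLS, mul_left_comm, hBS]
    nlinarith [mul_le_mul_of_nonneg_right h₀ hz, mul_le_mul_of_nonneg_right h₁ hy]
  rw [← div_eq_mul_inv, div_le_iff₀ hL, inv_mul_eq_div, le_div_iff₀ hB]
  exact le_of_mul_le_mul_left h hS

theorem inv_gain_two {S L B C y z a₀ a₁ b₀ b₁ c₀ c₁ κ : ℝ} (hy : 0 ≤ y) (hz : 0 ≤ z)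
    (hL : 0 < L) (hB : 0 < B) (hC : 0 < C) (hS : 0 < S) (hLS : S * L = a₁ * y + a₀ * z)
    (hBS : S * B = b₁ * y + b₀ * z) (hCS : S * C = c₁ * y + c₀ * z)
    (h₀ : κ * (b₀ * c₀) ≤ a₀ * (b₀ + c₀)) (h₁ : κ * (b₁ * c₁) ≤ a₁ * (b₁ + c₁))
    (h₂ : κ * (b₀ * c₁ + b₁ * c₀) ≤ a₀ * (b₁ + c₁) + a₁ * (b₀ + c₀)) :
    κ * L⁻¹ ≤ B⁻¹ + C⁻¹ := by
  have h : (S * S) * (κ * (B * C)) ≤ (S * S) * (L * (B + C)) := by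
    have e₁ : (S * S) * (κ * (B * C)) = κ * ((S * B) * (S * C)) := by ring
    have e₂ : (S * S) * (L * (B + C)) = (S * L) * (S * B + S * C) := by ring
    rw [e₁, e₂, hLS, hBS, hCS]
    nlinarith [mul_le_mul_of_nonneg_right h₀ (mul_nonneg hz hz),
      mul_le_mul_of_nonneg_right h₁ (mul_nonneg hy hy),
      mul_le_mul_of_nonneg_right h₂ (mul_nonneg hy hz)]
  have h' := le_of_mul_le_mul_left h (mul_pos hS hS)
  have e : B⁻¹ + C⁻¹ = (B + C) / (B * C) := by field_simp; ring
  rw [← div_eq_mul_inv, div_le_iff₀ hL, e, div_mul_eq_mul_div, le_div_iff₀ (mul_pos hB hC),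
    mul_comm (B + C)]
  exact h'

theorem scale_mul_formReal (r : CFState) (lo hi : ℕ) (q p : ℝ) :
    (100000 * (hi - lo : ℝ)) * r.formReal q p =
      r.endForm hi * (100000 * p - lo * q) + r.endForm lo * (hi * q - 100000 * p) := by
  simp only [formReal, endForm, form]
  push_cast
  ring

theorem scale_mul_formReal_child (c : CFState) (d lo hi : ℕ) (q p : ℝ) :
    (100000 * (hi - lo : ℝ)) * c.formReal (d * q + p) q =
      c.childForm d hi * (100000 * p - lo * q) + c.childForm d lo * (hi * q - 100000 * p) := by
  simp only [formReal, childForm, form]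
  push_cast
  ring

theorem formReal_pos {r : CFState} (hr : 0 < r.α) {q p : ℝ} (hq : 0 < q) (hp : 0 ≤ p) :
    0 < r.formReal q p := by
  have : (0 : ℝ) < r.α := by exact_mod_cast hr
  exact add_pos_of_pos_of_nonneg (by positivity) (by positivity)

theorem formReal_get_eq_zero {i : ℕ} (h : (get i).α = 0) (q p : ℝ) :
    (get i).formReal q p = 0 := by
  have h' : 449 ≤ i := by
    by_contra! h'
    have := α_pos_iff.2 h'
    omega
  simp [get_eq_of_le h', formReal]

/-- The continuants `q, p` have their ratio in the interval of the state `r`. -/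
structure Admits (r : CFState) (q p : ℝ) : Prop where
  pos : 0 < q
  nonneg : 0 ≤ p
  le : p ≤ q
  lo_le : r.lo * q ≤ 100000 * p
  le_hi : 100000 * p ≤ r.hi * q

theorem RatioOk.admits {r c : CFState} {d : ℕ} (h : r.RatioOk c d) (hd : 1 ≤ d) {q p : ℝ}
    (hqp : r.Admits q p) : c.Admits (d * q + p) q := by
  obtain ⟨hq, hp, hpq, hlo, hhi⟩ := hqp
  have hd' : (1 : ℝ) ≤ d := by exact_mod_cast hd
  have h₁ : (c.lo : ℝ) * (d * 100000 + r.hi) ≤ 100000 * 100000 := by exact_mod_cast h.1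
  have h₂ : (100000 : ℝ) * 100000 ≤ c.hi * (d * 100000 + r.lo) := by exact_mod_cast h.2
  refine ⟨by positivity, hq.le, by nlinarith, ?_, ?_⟩
  · have h₃ : (c.lo : ℝ) * (100000 * p) ≤ c.lo * (r.hi * q) := by gcongr
    have h₄ := mul_le_mul_of_nonneg_right h₁ hq.le
    nlinarith
  · have h₃ : (c.hi : ℝ) * (r.lo * q) ≤ c.hi * (100000 * p) := by gcongr
    have h₄ := mul_le_mul_of_nonneg_right h₂ hq.le
    nlinarith

/-- The weight of the successor of the state `i` along the digit `d`. -/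
noncomputable def childWeight (i d : ℕ) (q p : ℝ) : ℝ :=
  ((get ((get i).next d)).formReal (d * q + p) q)⁻¹

theorem childWeight_nonneg (i d : ℕ) {q p : ℝ} (hq : 0 ≤ q) (hp : 0 ≤ p) :
    0 ≤ childWeight i d q p :=
  inv_nonneg.2 <| add_nonneg (by positivity) (by positivity)

theorem next_lt_of_childWeight_pos {i d : ℕ} {q p : ℝ} (h : 0 < childWeight i d q p) :
    (get i).next d < 449 := by
  by_contra! h'
  simp [childWeight, get_eq_of_le h', formReal] at h

/-- The growth factor of the weights. -/
noncomputable def gain : ℝ := 10000003 / 10000000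

theorem gain_mul_weight_le {i : ℕ} (hi : i < 449) {q p : ℝ} (h : (get i).Admits q p) :
    gain * ((get i).formReal q p)⁻¹ ≤ childWeight i 1 q p + childWeight i 2 q p := by
  obtain ⟨hα, hlt, -, -, hex, h1, h2, h12⟩ := okWith_get hi
  obtain ⟨hq, hp, hpq, hlo, hhi⟩ := h
  have hL := formReal_pos hα hq hp
  have hS : (0 : ℝ) < 100000 * ((get i).hi - (get i).lo) := by
    have : ((get i).lo : ℝ) < (get i).hi := by exact_mod_cast hlt
    linarith
  have hy := sub_nonneg.2 hlo
  have hz := sub_nonneg.2 hhi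
  have hLS := scale_mul_formReal (get i) (get i).lo (get i).hi q p
  have hCS := fun c d => scale_mul_formReal_child c d (get i).lo (get i).hi q p
  have one : ∀ (c : CFState) (d : ℕ), 1 ≤ d → 0 < c.α → (get i).GainOne c d →
      gain * ((get i).formReal q p)⁻¹ ≤ (c.formReal (d * q + p) q)⁻¹ := by
    intro c d hd hc hg
    have e₀ : (10000003 : ℝ) * c.childForm d (get i).lo ≤
        10000000 * (get i).endForm (get i).lo := by exact_mod_cast hg.1
    have e₁ : (10000003 : ℝ) * c.childForm d (get i).hi ≤
        10000000 * (get i).endForm (get i).hi := by exact_mod_cast hg.2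
    have hd' : (1 : ℝ) ≤ d := by exact_mod_cast hd
    refine inv_gain_one hy hz hL (formReal_pos hc (by positivity) hq.le) hS hLS (hCS c d) ?_ ?_ <;>
      rw [gain] <;> linarith
  rcases Nat.eq_zero_or_pos (get ((get i).next 1)).α with hb | hb
  · have hc := hex.resolve_left (by omega)
    have := one _ 2 (by norm_num) hc (h1 hb)
    refine this.trans (le_add_of_nonneg_left (childWeight_nonneg i 1 hq.le hp))
  rcases Nat.eq_zero_or_pos (get ((get i).next 2)).α with hc | hc
  · have := one _ 1 le_rfl hb (h2 hc)
    refine this.trans (le_add_of_nonneg_right (childWeight_nonneg i 2 hq.le hp))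
  · obtain ⟨e₀, e₁, e₂⟩ := h12 hb hc
    have e₀' := (Nat.cast_le (α := ℝ)).2 e₀
    have e₁' := (Nat.cast_le (α := ℝ)).2 e₁
    have e₂' := (Nat.cast_le (α := ℝ)).2 e₂
    push_cast at e₀' e₁' e₂'
    refine inv_gain_two hy hz hL (formReal_pos hb (by positivity) hq.le)
      (formReal_pos hc (by positivity) hq.le) hS hLS (hCS _ 1) (hCS _ 2) ?_ ?_ ?_ <;>
      rw [gain] <;> linarith

end CFState

/-! ### Addresses of points of the unit interval -/

/-- A node of the tree of admissible words: the index of the current state, the last two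
continuants, and the relative position in the current subinterval. -/
structure CFNode where
  idx : ℕ
  q : ℝ
  p : ℝ
  u : ℝ

namespace CFNode

open CFState

/-- The proportion of the current subinterval allotted to the digit `1`. -/
noncomputable def ratio (s : CFNode) : ℝ :=
  childWeight s.idx 1 s.q s.p / (childWeight s.idx 1 s.q s.p + childWeight s.idx 2 s.q s.p)

open Classical in
/-- The next digit. -/
noncomputable def digit (s : CFNode) : ℕ := if s.u < s.ratio then 1 else 2

/-- The next node. -/
noncomputable def step (s : CFNode) : CFNode where
  idx := (get s.idx).next s.digit
  q := s.digit * s.q + s.p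
  p := s.q
  u := if s.digit = 1 then s.u / s.ratio else (s.u - s.ratio) / (1 - s.ratio)

/-- The weight of a node. -/
noncomputable def weight (s : CFNode) : ℝ := ((get s.idx).formReal s.q s.p)⁻¹

/-- The invariants of the nodes reached from the root. -/
structure Valid (s : CFNode) : Prop where
  idx_lt : s.idx < 449
  admits : (get s.idx).Admits s.q s.p
  nonneg : 0 ≤ s.u
  lt_one : s.u < 1

theorem digit_eq (s : CFNode) : s.digit = 1 ∨ s.digit = 2 := by
  unfold digit; split_ifs <;> simp

theorem weight_step (s : CFNode) : s.step.weight = childWeight s.idx s.digit s.q s.p := rfl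

theorem Valid.weight_pos {s : CFNode} (hs : s.Valid) : 0 < s.weight :=
  inv_pos.2 (formReal_pos (α_pos_iff.2 hs.idx_lt) hs.admits.pos hs.admits.nonneg)

theorem Valid.gain_mul_weight_le {s : CFNode} (hs : s.Valid) :
    gain * s.weight ≤ childWeight s.idx 1 s.q s.p + childWeight s.idx 2 s.q s.p :=
  CFState.gain_mul_weight_le hs.idx_lt hs.admits

theorem Valid.sum_pos {s : CFNode} (hs : s.Valid) :
    0 < childWeight s.idx 1 s.q s.p + childWeight s.idx 2 s.q s.p :=
  (mul_pos (by norm_num [gain]) hs.weight_pos).trans_le hs.gain_mul_weight_le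

theorem Valid.one_sub_ratio {s : CFNode} (hs : s.Valid) :
    1 - s.ratio = childWeight s.idx 2 s.q s.p /
      (childWeight s.idx 1 s.q s.p + childWeight s.idx 2 s.q s.p) := by
  have := hs.sum_pos
  rw [ratio]
  field_simp
  ring

theorem Valid.childWeight_pos {s : CFNode} (hs : s.Valid) :
    0 < childWeight s.idx s.digit s.q s.p := by
  have hsum := hs.sum_pos
  have hnn := fun d => childWeight_nonneg s.idx d hs.admits.pos.le hs.admits.nonneg
  refine (hnn _).lt_of_ne fun h => ?_
  unfold digit at h
  split_ifs at h with hu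
  · have : s.ratio = 0 := by rw [ratio, ← h, zero_div]
    linarith [hs.nonneg]
  · have h1 := hs.one_sub_ratio
    rw [← h, zero_div] at h1
    linarith [hs.lt_one]

theorem digit_eq_one_iff {s : CFNode} : s.digit = 1 ↔ s.u < s.ratio := by
  unfold digit; split_ifs with h <;> simp [h]

theorem Valid.step {s : CFNode} (hs : s.Valid) : s.step.Valid := by
  have hpos := hs.childWeight_pos
  have hlt := next_lt_of_childWeight_pos hpos
  have hu : 0 ≤ s.step.u ∧ s.step.u < 1 := by
    change 0 ≤ (if s.digit = 1 then s.u / s.ratio else (s.u - s.ratio) / (1 - s.ratio)) ∧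
      (if s.digit = 1 then s.u / s.ratio else (s.u - s.ratio) / (1 - s.ratio)) < 1
    have h0 := hs.nonneg
    have h1 := hs.lt_one
    split_ifs with h <;> rw [digit_eq_one_iff] at h
    · have hr : 0 < s.ratio := h0.trans_lt h
      exact ⟨by positivity, (div_lt_one hr).2 h⟩
    · rw [not_lt] at h
      have hr : 0 < 1 - s.ratio := by linarith
      exact ⟨div_nonneg (by linarith) hr.le, (div_lt_one hr).2 (by linarith)⟩
  obtain ⟨-, -, hr1, hr2, -⟩ := okWith_get hs.idx_lt
  refine ⟨hlt, ?_, hu.1, hu.2⟩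
  change (get ((get s.idx).next s.digit)).Admits (s.digit * s.q + s.p) s.q
  rcases digit_eq s with h | h <;> rw [h] at hlt ⊢
  · exact (hr1 (α_pos_iff.2 hlt)).admits le_rfl hs.admits
  · exact (hr2 (α_pos_iff.2 hlt)).admits (by norm_num) hs.admits

theorem Valid.weight_le {s : CFNode} (hs : s.Valid) : s.weight ≤ s.q⁻¹ := by
  have h1 : (1 : ℝ) ≤ (get s.idx).α := by exact_mod_cast α_pos_iff.2 hs.idx_lt
  have hq := hs.admits.pos
  have hp := hs.admits.nonneg
  refine inv_anti₀ hq ?_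
  have : 0 ≤ ((get s.idx).β : ℝ) * s.p := by positivity
  rw [formReal]
  nlinarith

theorem weight_mul_abs_sub_le {s t : CFNode} (hs : s.Valid)
    (hidx : s.idx = t.idx) (hq : s.q = t.q) (hp : s.p = t.p) (hd : s.digit = t.digit) :
    gain * s.weight * |s.u - t.u| ≤ s.step.weight * |s.step.u - t.step.u| := by
  have hsum := hs.sum_pos
  have hpos := hs.childWeight_pos
  have hgain := mul_le_mul_of_nonneg_right hs.gain_mul_weight_le (abs_nonneg (s.u - t.u))
  refine hgain.trans (le_of_eq ?_)
  have hr : t.ratio = s.ratio := by rw [ratio, ratio, hidx, hq, hp]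
  have e : (childWeight s.idx 1 s.q s.p + childWeight s.idx 2 s.q s.p) * (s.u - t.u) =
      childWeight s.idx s.digit s.q s.p * (s.step.u - t.step.u) := by
    have hsu : s.step.u = if s.digit = 1 then s.u / s.ratio else
      (s.u - s.ratio) / (1 - s.ratio) := rfl
    have htu : t.step.u = if s.digit = 1 then t.u / s.ratio else
      (t.u - s.ratio) / (1 - s.ratio) := by rw [hd, ← hr]; rfl
    rw [hsu, htu]
    rcases digit_eq s with h | h <;> rw [h] at hpos ⊢
    · rw [if_pos rfl, if_pos rfl, ratio]
      field_simp
    · rw [if_neg (by norm_num), if_neg (by norm_num), hs.one_sub_ratio]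
      field_simp
      ring
  rw [weight_step, ← abs_of_pos hsum, ← abs_mul, e, abs_mul, abs_of_pos hpos]

/-- The node reached after `n` digits of the address of `t`. -/
noncomputable def orbit (t : ℝ) (n : ℕ) : CFNode :=
  step^[n] ⟨0, 1, (get 0).lo / 100000, t⟩

/-- The address of `t`, as a sequence of digits. -/
noncomputable def address (t : ℝ) (n : ℕ) : ℕ := (orbit t n).digit

theorem orbit_succ (t : ℝ) (n : ℕ) : orbit t (n + 1) = (orbit t n).step :=
  Function.iterate_succ_apply' _ _ _

theorem address_eq (t : ℝ) (n : ℕ) : address t n = 1 ∨ address t n = 2 := digit_eq _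

theorem valid_orbit {t : ℝ} (ht : t ∈ Set.Ico (0 : ℝ) 1) (n : ℕ) : (orbit t n).Valid := by
  induction n with
  | zero =>
    refine ⟨by norm_num [orbit], ⟨zero_lt_one, ?_, ?_, ?_, ?_⟩, ht.1, ht.2⟩
    · change (0 : ℝ) ≤ (get 0).lo / 100000
      positivity
    · change ((get 0).lo / 100000 : ℝ) ≤ 1
      have h : (get 0).lo ≤ 100000 := by decide +kernel
      have h' : ((get 0).lo : ℝ) ≤ 100000 := by exact_mod_cast h
      rw [div_le_one (by norm_num)]
      exact h'
    · change ((get 0).lo : ℝ) * 1 ≤ 100000 * ((get 0).lo / 100000)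
      linarith
    · change (100000 * ((get 0).lo / 100000) : ℝ) ≤ (get 0).hi * 1
      have h' : ((get 0).lo : ℝ) < (get 0).hi := by
        exact_mod_cast (okWith_get (i := 0) (by norm_num)).2.1
      linarith
  | succ n ih => rw [orbit_succ]; exact ih.step

theorem orbit_q_le {t : ℝ} (ht : t ∈ Set.Ico (0 : ℝ) 1) (n : ℕ) : (orbit t n).q ≤ 3 ^ n := by
  induction n with
  | zero => simp [orbit]
  | succ n ih =>
    rw [orbit_succ, pow_succ]
    change ((orbit t n).digit : ℝ) * (orbit t n).q + (orbit t n).p ≤ _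
    have h := (valid_orbit ht n).admits
    have hd : ((orbit t n).digit : ℝ) ≤ 2 := by
      exact_mod_cast (show (orbit t n).digit ≤ 2 by have := digit_eq (orbit t n); omega)
    nlinarith [h.pos, h.le]

theorem one_le_orbit_q {t : ℝ} (ht : t ∈ Set.Ico (0 : ℝ) 1) (n : ℕ) : 1 ≤ (orbit t n).q := by
  induction n with
  | zero => simp [orbit]
  | succ n ih =>
    have h := (valid_orbit ht (n + 1)).admits.le
    rw [orbit_succ] at h ⊢
    exact ih.trans h

theorem orbit_congr {s t : ℝ} {n : ℕ} (h : ∀ k < n, address s k = address t k) :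
    (orbit s n).idx = (orbit t n).idx ∧ (orbit s n).q = (orbit t n).q ∧
      (orbit s n).p = (orbit t n).p := by
  induction n with
  | zero => exact ⟨rfl, rfl, rfl⟩
  | succ n ih =>
    obtain ⟨h1, h2, h3⟩ := ih fun k hk => h k (by omega)
    have hd : (orbit s n).digit = (orbit t n).digit := h n (by omega)
    simp only [orbit_succ, step, h1, h2, h3, hd, and_self]

theorem gain_pow_mul_abs_sub_le {s t : ℝ} (hs : s ∈ Set.Ico (0 : ℝ) 1)
    {n : ℕ} (h : ∀ k < n, address s k = address t k) :
    gain ^ n * ((orbit 0 0).weight * |s - t|) ≤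
      (orbit s n).weight * |(orbit s n).u - (orbit t n).u| := by
  induction n with
  | zero => rw [pow_zero, one_mul]; rfl
  | succ n ih =>
    have h' : ∀ k < n, address s k = address t k := fun k hk => h k (by omega)
    obtain ⟨h1, h2, h3⟩ := orbit_congr h'
    have key := weight_mul_abs_sub_le (valid_orbit hs n) h1 h2 h3
      (h n (by omega))
    rw [← orbit_succ, ← orbit_succ] at key
    refine le_trans ?_ key
    rw [pow_succ', mul_assoc, mul_assoc]
    exact mul_le_mul_of_nonneg_left (ih h') (by norm_num [gain])

theorem abs_sub_mul_le {s t : ℝ} (hs : s ∈ Set.Ico (0 : ℝ) 1)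
    (ht : t ∈ Set.Ico (0 : ℝ) 1) {n : ℕ} (h : ∀ k < n, address s k = address t k) :
    (orbit 0 0).weight * |s - t| * (gain ^ n * (orbit s n).q) ≤ 1 := by
  have hv := valid_orbit hs n
  have hv' := valid_orbit ht n
  have hu : |(orbit s n).u - (orbit t n).u| ≤ 1 := by
    rw [abs_le]
    constructor <;> linarith [hv.nonneg, hv.lt_one, hv'.nonneg, hv'.lt_one]
  have h1 := (gain_pow_mul_abs_sub_le hs h).trans
    (mul_le_of_le_one_right hv.weight_pos.le hu)
  have h2 := h1.trans hv.weight_le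
  have hq := hv.admits.pos
  have h3 := mul_le_mul_of_nonneg_right h2 hq.le
  rw [inv_mul_cancel₀ hq.ne'] at h3
  linarith

/-- The excess of the Hölder exponent over `1 / 2`. -/
noncomputable def excess : ℝ := Real.log gain / (2 * Real.log 3)

theorem excess_pos : 0 < excess :=
  div_pos (Real.log_pos (by norm_num [gain])) (mul_pos two_pos (Real.log_pos (by norm_num)))

theorem three_rpow_excess : (3 : ℝ) ^ (2 * excess) = gain := by
  have h3 : 0 < Real.log 3 := Real.log_pos (by norm_num)
  rw [Real.rpow_def_of_pos (by norm_num), excess,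
    show Real.log 3 * (2 * (Real.log gain / (2 * Real.log 3))) = Real.log gain by field_simp,
    Real.exp_log (by norm_num [gain])]

theorem abs_sub_le_of_first_difference {s t : ℝ} (hs : s ∈ Set.Ico (0 : ℝ) 1)
    (ht : t ∈ Set.Ico (0 : ℝ) 1) {n : ℕ} (h : ∀ k < n, address s k = address t k)
    (hn : address s n ≠ address t n) :
    (orbit 0 0).weight * |s - t| ≤
      (576 * |cf01 (address s) - cf01 (address t)|) ^ (1 / 2 + excess) := by
  have hv := valid_orbit hs n
  have hsep := le_abs_cf01_sub n (fun k => (orbit s k).p) (address s) (address t) (address_eq s)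
    (address_eq t) h hn (fun k _ => by simp only [orbit_succ]; rfl)
    (valid_orbit hs 0).admits.nonneg (by simp only [orbit_succ]; rfl) hv.admits.nonneg
    (by simp only [orbit_succ]; exact hv.admits.le)
  have hp : (orbit s (n + 1)).p = (orbit s n).q := by rw [orbit_succ]; rfl
  rw [hp] at hsep
  have hle := abs_sub_mul_le hs ht h
  have hq3 := orbit_q_le hs n
  have hq := hv.admits.pos
  set q := (orbit s n).q
  set x := |cf01 (address s) - cf01 (address t)|
  have hx : 0 ≤ x := abs_nonneg _
  have hqe : q ^ (2 * excess) ≤ gain ^ n := by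
    calc q ^ (2 * excess) ≤ ((3 : ℝ) ^ n) ^ (2 * excess) :=
          Real.rpow_le_rpow hq.le hq3 (by linarith [excess_pos])
      _ = gain ^ n := by
          rw [← three_rpow_excess, ← Real.rpow_natCast, ← Real.rpow_natCast, ← Real.rpow_mul
            (by norm_num), ← Real.rpow_mul (by norm_num), mul_comm]
  have hge : 1 ≤ (576 * x) ^ (1 / 2 + excess) * (gain ^ n * q) := by
    calc (1 : ℝ) ≤ (576 * x * q ^ 2) ^ (1 / 2 + excess) :=
          Real.one_le_rpow (by linarith) (by linarith [excess_pos])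
      _ = (576 * x) ^ (1 / 2 + excess) * (q ^ (2 * excess) * q) := by
          rw [Real.mul_rpow (by positivity) (by positivity), ← Real.rpow_natCast q 2,
            ← Real.rpow_mul hq.le,
            show ((2 : ℕ) : ℝ) * (1 / 2 + excess) = 2 * excess + 1 by push_cast; ring,
            Real.rpow_add hq, Real.rpow_one]
      _ ≤ _ := by gcongr
  have hpos : 0 < gain ^ n * q := mul_pos (pow_pos (by norm_num [gain]) _) hq
  exact le_of_mul_le_mul_right (hle.trans hge) hpos

theorem abs_sub_le {s t : ℝ} (hs : s ∈ Set.Ico (0 : ℝ) 1) (ht : t ∈ Set.Ico (0 : ℝ) 1) :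
    (orbit 0 0).weight * |s - t| ≤
      (576 * |cf01 (address s) - cf01 (address t)|) ^ (1 / 2 + excess) := by
  by_cases h : ∃ n, address s n ≠ address t n
  · classical
    exact abs_sub_le_of_first_difference hs ht (fun k hk => not_not.1 (Nat.find_min h hk))
      (Nat.find_spec h)
  · push Not at h
    refine le_trans ?_ (Real.rpow_nonneg (by positivity) _)
    by_contra! hpos
    obtain ⟨n, hn⟩ := pow_unbounded_of_one_lt ((orbit 0 0).weight * |s - t|)⁻¹
      (show (1 : ℝ) < gain by norm_num [gain])
    have h1 := abs_sub_mul_le hs ht (n := n) fun k _ => h k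
    have h2 : gain ^ n * 1 ≤ gain ^ n * (orbit s n).q :=
      mul_le_mul_of_nonneg_left (one_le_orbit_q hs n) (pow_nonneg (by norm_num [gain]) _)
    have h3 := (mul_le_mul_of_nonneg_left h2 hpos.le).trans h1
    rw [mul_one, ← le_inv_mul_iff₀ hpos, mul_one] at h3
    exact h3.not_gt hn

theorem cf01_address_mem {t : ℝ} (ht : t ∈ Set.Ico (0 : ℝ) 1) :
    cf01 (address t) ∈ gaussCantorRev {1, 2} forbiddenY := by
  refine ⟨address t, fun n => address_eq t n, fun w hw i => ?_, rfl⟩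
  have hidx : ∀ k, (orbit t k).idx < 449 := fun k => (valid_orbit ht k).idx_lt
  have hstep : ∀ k, (orbit t (k + 1)).idx = (get (orbit t k).idx).next (address t k) :=
    fun k => by rw [orbit_succ]; rfl
  obtain ⟨h1, h2⟩ := rejects_of_mem w hw
  exact ⟨not_occursAtN_of_rejects hidx hstep w 0 449 i h1 (Nat.zero_le _) (hidx i),
    not_occursAtN_of_rejects hidx hstep w.reverse 0 449 i h2 (Nat.zero_le _) (hidx i)⟩

end CFNode

/-- A set containing the image of `[0, 1)` under a map with `r`-Hölder inverse has dimension at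
least `r`. -/
theorem le_dimH_of_abs_sub_le {f : ℝ → ℝ} {E : Set ℝ} {c : ℝ} {r : NNReal} (hr : 0 < r)
    (hc : 0 ≤ c) (hE : ∀ t ∈ Set.Ico (0 : ℝ) 1, f t ∈ E)
    (hf : ∀ s ∈ Set.Ico (0 : ℝ) 1, ∀ t ∈ Set.Ico (0 : ℝ) 1,
      |s - t| ≤ c * |f s - f t| ^ (r : ℝ)) :
    (r : ENNReal) ≤ dimH E := by
  have hinj : Set.InjOn f (Set.Ico 0 1) := by
    intro s hs t ht hst
    have h := hf s hs t ht
    rw [hst, sub_self, abs_zero, Real.zero_rpow (NNReal.coe_pos.2 hr).ne', mul_zero] at h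
    exact sub_eq_zero.1 (abs_nonpos_iff.1 h)
  set g := Function.invFunOn f (Set.Ico 0 1)
  have hg : ∀ t ∈ Set.Ico (0 : ℝ) 1, g (f t) = t := fun t ht => hinj.leftInvOn_invFunOn ht
  have hol : HolderOnWith c.toNNReal r g (f '' Set.Ico 0 1) := by
    rintro _ ⟨s, hs, rfl⟩ _ ⟨t, ht, rfl⟩
    rw [hg s hs, hg t ht, edist_dist, edist_dist, ENNReal.ofReal_rpow_of_nonneg dist_nonneg
      r.coe_nonneg, ← ENNReal.ofReal, ← ENNReal.ofReal_mul hc]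
    exact ENNReal.ofReal_le_ofReal (hf s hs t ht)
  have himg : g '' (f '' Set.Ico 0 1) = Set.Ico 0 1 := by
    rw [Set.image_image, Set.image_congr hg, Set.image_id']
  have h1 := hol.dimH_image_le hr
  have h2 : dimH (Set.Ico (0 : ℝ) 1) = 1 := by
    rw [Real.dimH_of_nonempty_interior (by simp), Module.finrank_self, Nat.cast_one]
  rw [himg, h2] at h1
  rw [ENNReal.le_div_iff_mul_le (Or.inl (by exact_mod_cast hr.ne')) (Or.inl ENNReal.coe_ne_top),
    one_mul] at h1
  exact h1.trans (dimH_mono (Set.image_subset_iff.2 hE))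

/-- `dim_H Y > 0.5`, where `Y` is the set of reals whose continued fraction partial
quotients lie in `{1,2}` and avoid the twenty-five listed strings and their reverses. -/
theorem dimH_Y_gt :
    ENNReal.ofReal 0.5 < dimH (gaussCantorRev {1, 2} forbiddenY) := by
  have he := CFNode.excess_pos
  have hw : 0 < (CFNode.orbit 0 0).weight := (CFNode.valid_orbit (by simp) 0).weight_pos
  have hr : (0 : ℝ) ≤ 1 / 2 + CFNode.excess := by linarith
  refine lt_of_lt_of_le ?_ (le_dimH_of_abs_sub_le (f := fun t => cf01 (CFNode.address t))
    (r := (1 / 2 + CFNode.excess).toNNReal) (Real.toNNReal_pos.2 (by linarith))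
    (c := (CFNode.orbit 0 0).weight⁻¹ * 576 ^ (1 / 2 + CFNode.excess)) (by positivity)
    (fun t ht => CFNode.cf01_address_mem ht) fun s hs t ht => ?_)
  · exact (ENNReal.ofReal_lt_ofReal_iff (by linarith)).2 (by norm_num; linarith)
  · have h := CFNode.abs_sub_le hs ht
    rw [Real.mul_rpow (by norm_num) (abs_nonneg _)] at h
    rw [Real.coe_toNNReal _ hr, mul_assoc, inv_mul_eq_div, le_div_iff₀' hw]
    exact h
end

section
/- Let K(C1) be the set of real numbers [0; a1, a2, …] whose continued fraction partial quotients all lie in {1,2} and whose digit sequence contains none of the strings 121, 212, 2111222, 2221112 as a consecutive substring. Then M ∩ (√5, 3.042] ⊆ 2 + K(C1) + K(C1), and consequently dim_H(M ∩ (√5, 3.042]) ≤ 2·dim_H K(C1) < 0.693, where M is the Markov spectrum. -/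
open Filter

/-- The forbidden words defining the Gauss–Cantor set `K(C₁)`. -/
def forbiddenC1 : List (List ℕ) :=
  [[1, 2, 1], [2, 1, 2], [2, 1, 1, 1, 2, 2, 2], [2, 2, 2, 1, 1, 1, 2]]

namespace ContFrac

/-! ### Convergence of infinite continued fractions -/

/-- The sequence with its first term removed. -/
def tail {α : Type*} (a : ℕ → α) : ℕ → α := fun n => a (n + 1)

lemma cfNum_cfDen_succ (a : ℕ → ℕ) (n : ℕ) :
    cfNum a (n + 1) = a 0 * cfNum (tail a) n + cfDen (tail a) n ∧
      cfDen a (n + 1) = cfNum (tail a) n := by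
  induction n using Nat.strong_induction_on with
  | _ n ih =>
    match n with
    | 0 => simp [cfNum, cfDen, tail, mul_comm]
    | 1 => simp [cfNum, cfDen, tail]; ring
    | n + 2 =>
      obtain ⟨h1, h2⟩ := ih n (by omega)
      obtain ⟨h3, h4⟩ := ih (n + 1) (by omega)
      constructor
      · rw [cfNum, h3, h1, cfNum, cfDen]; simp only [tail]; ring
      · rw [cfDen, h4, h2, cfNum]; simp only [tail]

lemma cfNum_pos_cfDen_pos {a : ℕ → ℕ} (ha : ∀ n, 1 ≤ a n) (n : ℕ) :
    0 < cfNum a n ∧ 0 < cfDen a n := by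
  induction n using Nat.strong_induction_on with
  | _ n ih =>
    match n with
    | 0 => exact ⟨ha 0, by simp [cfDen]⟩
    | 1 => exact ⟨by simp [cfNum], ha 1⟩
    | n + 2 =>
      have h := ih n (by omega)
      rw [cfNum, cfDen]
      exact ⟨by omega, by omega⟩

/-- The `n`-th convergent. -/
noncomputable def convergent (a : ℕ → ℕ) (n : ℕ) : ℝ := (cfNum a n : ℝ) / cfDen a n

lemma convergent_zero (a : ℕ → ℕ) : convergent a 0 = a 0 := by
  simp [convergent, cfNum, cfDen]

lemma convergent_succ {a : ℕ → ℕ} (ha : ∀ n, 1 ≤ a n) (n : ℕ) :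
    convergent a (n + 1) = a 0 + 1 / convergent (tail a) n := by
  obtain ⟨h1, h2⟩ := cfNum_cfDen_succ a n
  have h3 : (0 : ℝ) < cfNum (tail a) n := by
    exact_mod_cast (cfNum_pos_cfDen_pos (a := tail a) (fun n => ha _) n).1
  rw [convergent, convergent, h1, h2]
  push_cast
  field_simp

lemma convergent_mem {a : ℕ → ℕ} (ha : ∀ n, 1 ≤ a n) (n : ℕ) :
    (a 0 : ℝ) ≤ convergent a n ∧ convergent a n ≤ a 0 + 1 := by
  induction n generalizing a with
  | zero => rw [convergent_zero]; constructor <;> linarith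
  | succ n ih =>
    have h := (ih (a := tail a) (fun n => ha _)).1
    have h1 : (1 : ℝ) ≤ tail a 0 := by exact_mod_cast ha 1
    have h2 : (1 : ℝ) ≤ convergent (tail a) n := h1.trans h
    rw [convergent_succ ha]
    have h3 : 1 / convergent (tail a) n ≤ 1 := by rw [div_le_one (by linarith)]; exact h2
    have h4 : 0 ≤ 1 / convergent (tail a) n := by positivity
    constructor <;> linarith

lemma one_le_convergent {a : ℕ → ℕ} (ha : ∀ n, 1 ≤ a n) (n : ℕ) : 1 ≤ convergent a n := by
  have h1 : (1 : ℝ) ≤ a 0 := by exact_mod_cast ha 0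
  exact h1.trans (convergent_mem ha n).1

lemma abs_convergent_sub_succ_le {a : ℕ → ℕ} (ha : ∀ n, 1 ≤ a n) (n : ℕ) :
    |convergent a n - convergent a (n + 1)| ≤ 2 * (1 / 2) ^ n := by
  induction n using Nat.strong_induction_on generalizing a with
  | _ n ih =>
    have hb := convergent_mem ha n
    have hb' := convergent_mem ha (n + 1)
    match n with
    | 0 => rw [abs_le]; constructor <;> norm_num <;> linarith
    | 1 => rw [abs_le]; constructor <;> norm_num <;> linarith
    | n + 2 =>
      have hat : ∀ n, 1 ≤ tail a n := fun n => ha _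
      have hatt : ∀ n, 1 ≤ tail (tail a) n := fun n => ha _
      have h := ih n (by omega) hatt
      rw [convergent_succ ha, convergent_succ ha (n + 2), convergent_succ hat,
        convergent_succ hat (n + 1)]
      set u := convergent (tail (tail a)) n
      set v := convergent (tail (tail a)) (n + 1)
      have hu : 1 ≤ u := one_le_convergent hatt n
      have hv : 1 ≤ v := one_le_convergent hatt (n + 1)
      have hd : (1 : ℝ) ≤ tail a 0 := by exact_mod_cast hat 0
      set d : ℝ := ((tail a 0 : ℕ) : ℝ)
      have hdu : 2 ≤ d * u + 1 := by nlinarith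
      have hdv : 2 ≤ d * v + 1 := by nlinarith
      have e : (a 0 : ℝ) + 1 / (d + 1 / u) - (a 0 + 1 / (d + 1 / v)) =
          (u - v) / ((d * u + 1) * (d * v + 1)) := by
        have : u ≠ 0 := by positivity
        have : v ≠ 0 := by positivity
        have : d * u + 1 ≠ 0 := by positivity
        have : d * v + 1 ≠ 0 := by positivity
        field_simp
        ring
      rw [e, abs_div, abs_of_pos (a := (d * u + 1) * (d * v + 1)) (by positivity),
        div_le_iff₀ (by positivity)]
      have h4 : 4 ≤ (d * u + 1) * (d * v + 1) := by nlinarith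
      calc |u - v| ≤ 2 * (1 / 2) ^ n := h
        _ = 2 * (1 / 2) ^ (n + 2) * 4 := by ring
        _ ≤ _ := by gcongr

lemma tendsto_convergent {a : ℕ → ℕ} (ha : ∀ n, 1 ≤ a n) :
    Tendsto (convergent a) atTop (nhds (cfVal a)) := by
  have h : CauchySeq (convergent a) :=
    cauchySeq_of_le_geometric (1 / 2) 2 (by norm_num) fun n => by
      rw [Real.dist_eq]; exact abs_convergent_sub_succ_le ha n
  exact h.tendsto_limUnder

lemma one_le_cfVal {a : ℕ → ℕ} (ha : ∀ n, 1 ≤ a n) : 1 ≤ cfVal a :=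
  ge_of_tendsto' (tendsto_convergent ha) (one_le_convergent ha)

lemma cfVal_eq {a : ℕ → ℕ} (ha : ∀ n, 1 ≤ a n) : cfVal a = a 0 + cf01 (tail a) := by
  have hat : ∀ n, 1 ≤ tail a n := fun n => ha _
  have h1 := (tendsto_convergent ha).comp (tendsto_add_atTop_nat 1)
  have h2 : Tendsto (fun n => (a 0 : ℝ) + 1 / convergent (tail a) n) atTop
      (nhds (a 0 + 1 / cfVal (tail a))) := by
    refine tendsto_const_nhds.add (tendsto_const_nhds.div (tendsto_convergent hat) ?_)
    have := one_le_cfVal hat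
    positivity
  refine tendsto_nhds_unique h1 (h2.congr fun n => ?_)
  exact (convergent_succ ha n).symm

lemma cf01_mem {a : ℕ → ℕ} (ha : ∀ n, 1 ≤ a n) : 0 ≤ cf01 a ∧ cf01 a ≤ 1 := by
  have h := one_le_cfVal ha
  unfold cf01
  exact ⟨by positivity, by rw [div_le_one (by linarith)]; exact h⟩

lemma cf01_eq {a : ℕ → ℕ} (ha : ∀ n, 1 ≤ a n) : cf01 a = 1 / (a 0 + cf01 (tail a)) := by
  rw [← cfVal_eq ha, cf01]

/-! ### Continued fractions with partial quotients in `{1, 2}` -/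

/-- The partial quotient encoded by a boolean. -/
def digit (b : Bool) : ℕ := if b then 2 else 1

lemma one_le_digit (b : Bool) : 1 ≤ digit b := by cases b <;> simp [digit]

lemma digit_le_two (b : Bool) : digit b ≤ 2 := by cases b <;> simp [digit]

/-- The value `[0; a 0, a 1, …]` for partial quotients encoded by booleans. -/
noncomputable def value (a : ℕ → Bool) : ℝ := cf01 fun n => digit (a n)

lemma value_eq (a : ℕ → Bool) : value a = 1 / (digit (a 0) + value (tail a)) :=
  cf01_eq (a := fun n => digit (a n)) fun _ => one_le_digit _

lemma value_mem_step {l h : ℝ} (hl : 0 ≤ l) (H : ∀ a, l ≤ value a ∧ value a ≤ h) (a : ℕ → Bool) :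
    1 / (2 + h) ≤ value a ∧ value a ≤ 1 / (1 + l) := by
  have h1 : (1 : ℝ) ≤ digit (a 0) := by exact_mod_cast one_le_digit _
  have h2 : (digit (a 0) : ℝ) ≤ 2 := by exact_mod_cast digit_le_two _
  have h3 := H (tail a)
  rw [value_eq]
  constructor
  · apply one_div_le_one_div_of_le <;> linarith
  · apply one_div_le_one_div_of_le <;> linarith

lemma value_mem (a : ℕ → Bool) : 0.366 ≤ value a ∧ value a ≤ 0.7321 := by
  have h0 : ∀ a, 0 ≤ value a ∧ value a ≤ 1 := fun a => cf01_mem fun _ => one_le_digit _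
  have h1 := value_mem_step (by norm_num) h0
  have h2 := value_mem_step (by norm_num) h1
  have h3 := value_mem_step (by norm_num) h2
  have h4 := value_mem_step (by norm_num) h3
  have h5 := value_mem_step (by norm_num) h4
  have h6 := value_mem_step (by norm_num) h5
  have h7 := value_mem_step (by norm_num) h6
  have h8 := value_mem_step (by norm_num) h7
  obtain ⟨hl, hu⟩ := h8 a
  constructor
  · refine le_trans ?_ hl; norm_num
  · refine hu.trans ?_; norm_num

lemma value_pos (a : ℕ → Bool) : 0 < value a := by
  have := (value_mem a).1
  linarith

lemma one_div_value_sub (a : ℕ → Bool) : 1 / value a - digit (a 0) = value (tail a) := by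
  rw [value_eq a, one_div_one_div]; ring

lemma abs_value_sub_of_head_eq {a b : ℕ → Bool} (h : a 0 = b 0) :
    |value a - value b| = value a * value b * |value (tail a) - value (tail b)| := by
  have ha := value_pos a
  have hb := value_pos b
  rw [← one_div_value_sub a, ← one_div_value_sub b, h]
  have : 1 / value a - digit (b 0) - (1 / value b - digit (b 0)) =
      (value b - value a) / (value a * value b) := by field_simp; ring
  rw [this, abs_div, abs_of_pos (mul_pos ha hb), abs_sub_comm]
  field_simp

/-- The product of the values of the first `n` tails of a sequence. -/
noncomputable def tailProd : ℕ → (ℕ → Bool) → ℝ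
  | 0, _ => 1
  | n + 1, a => value a * tailProd n (tail a)

lemma tailProd_pos (n : ℕ) (a : ℕ → Bool) : 0 < tailProd n a := by
  induction n generalizing a with
  | zero => simp [tailProd]
  | succ n ih => exact mul_pos (value_pos a) (ih _)

lemma tailProd_le (n : ℕ) (a : ℕ → Bool) : tailProd n a ≤ (3 / 4) ^ n := by
  induction n generalizing a with
  | zero => simp [tailProd]
  | succ n ih =>
    have h1 := (value_mem a).2
    rw [tailProd, pow_succ']
    exact mul_le_mul (by linarith) (ih _) (tailProd_pos n _).le (by norm_num)

lemma tail_iterate {α : Type*} (n : ℕ) (a : ℕ → α) (i : ℕ) : tail^[n] a i = a (i + n) := by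
  induction n generalizing a with
  | zero => rfl
  | succ n ih => rw [Function.iterate_succ_apply, ih, tail, add_assoc]

lemma abs_value_sub_of_agree {n : ℕ} {a b : ℕ → Bool} (h : ∀ i < n, a i = b i) :
    |value a - value b| =
      tailProd n a * tailProd n b * |value (tail^[n] a) - value (tail^[n] b)| := by
  induction n generalizing a b with
  | zero => simp [tailProd]
  | succ n ih =>
    rw [abs_value_sub_of_head_eq (h 0 (by omega)),
      ih (a := tail a) (b := tail b) fun i hi => h (i + 1) (by omega)]
    simp only [tailProd, Function.iterate_succ_apply]
    ring

/-- The reciprocal of `tailProd n` is an affine function of the value of the `n`-th tail, on the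
sequences with a given prefix of length `n`. -/
lemma exists_tailProd_eq (n : ℕ) (a : ℕ → Bool) :
    ∃ p q : ℝ, 0 ≤ p ∧ p ≤ q ∧ 0 < q ∧ ∀ b : ℕ → Bool, (∀ i < n, a i = b i) →
      tailProd n b * (q + p * value (tail^[n] b)) = 1 := by
  have key : ∀ (n : ℕ) (b : ℕ → Bool),
      tailProd (n + 1) b = tailProd n b * value (tail^[n] b) := by
    intro n
    induction n with
    | zero => intro b; simp [tailProd]
    | succ n ih =>
      intro b
      rw [tailProd, ih, Function.iterate_succ_apply, tailProd]
      ring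
  induction n with
  | zero => exact ⟨0, 1, le_rfl, zero_le_one, one_pos, fun b _ => by simp [tailProd]⟩
  | succ n ih =>
    obtain ⟨p, q, hp, hpq, hq, h⟩ := ih
    have hd : (1 : ℝ) ≤ digit (a n) := by exact_mod_cast one_le_digit _
    refine ⟨q, q * digit (a n) + p, hq.le, by nlinarith, by positivity, fun b hb => ?_⟩
    have e := h b fun i hi => hb i (by omega)
    have e2 := one_div_value_sub (tail^[n] b)
    have hz : tail^[n] b 0 = b n := by rw [tail_iterate, zero_add]
    have hv := value_pos (tail^[n] b)
    rw [hz, ← hb n (by omega)] at e2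
    rw [key, Function.iterate_succ_apply', ← e2]
    refine Eq.trans ?_ e
    field_simp
    ring

lemma tailProd_le_two_mul {n : ℕ} {a b : ℕ → Bool} (h : ∀ i < n, a i = b i) :
    tailProd n a ≤ 2 * tailProd n b := by
  obtain ⟨p, q, hp, hpq, hq, H⟩ := exists_tailProd_eq n a
  have ha := H a fun _ _ => rfl
  have hb := H b h
  have hva := value_mem (tail^[n] a)
  have hvb := value_mem (tail^[n] b)
  have h1 : q ≤ q + p * value (tail^[n] a) := by nlinarith
  have h2 : q + p * value (tail^[n] b) ≤ 2 * q := by nlinarith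
  have pa := tailProd_pos n a
  have pb := tailProd_pos n b
  have h3 : tailProd n a * q ≤ 1 := by nlinarith
  have h4 : 1 ≤ tailProd n b * (2 * q) := by nlinarith
  nlinarith

lemma continuous_value : Continuous value := by
  rw [continuous_iff_continuousAt]
  intro a
  rw [ContinuousAt, Metric.tendsto_nhds]
  intro ε hε
  obtain ⟨n, hn⟩ := exists_pow_lt_of_lt_one hε (show (3 / 4 : ℝ) < 1 by norm_num)
  have hev : ∀ᶠ b in nhds a, ∀ i ∈ Set.Iio n, b i = a i := by
    rw [Filter.eventually_all_finite (Set.finite_Iio n)]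
    intro i _
    have : Tendsto (fun b : ℕ → Bool => b i) (nhds a) (nhds (a i)) :=
      (continuous_apply i).tendsto a
    rw [nhds_discrete Bool, tendsto_pure] at this
    exact this
  filter_upwards [hev] with b hb
  rw [Real.dist_eq, abs_value_sub_of_agree (n := n) fun i hi => hb i hi]
  have h1 := value_mem (tail^[n] a)
  have h2 := value_mem (tail^[n] b)
  have h3 : |value (tail^[n] b) - value (tail^[n] a)| ≤ 1 := by
    rw [abs_le]; constructor <;> linarith
  have h4 : tailProd n b ≤ 1 := (tailProd_le n b).trans (pow_le_one₀ (by norm_num) (by norm_num))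
  have h5 := tailProd_le n a
  have p1 := tailProd_pos n a
  have p2 := tailProd_pos n b
  calc _ ≤ 1 * (3 / 4) ^ n * 1 := by gcongr
    _ < ε := by linarith

lemma le_abs_value_sub_of_head_ne {a b : ℕ → Bool} (h : a 0 ≠ b 0) :
    0.1 ≤ |value a - value b| := by
  have key : ∀ a : ℕ → Bool,
      (a 0 = true → value a ≤ 0.43) ∧ (a 0 = false → 0.57 ≤ value a) := by
    intro a
    have h1 := value_mem (tail a)
    constructor
    · intro ha
      rw [value_eq, ha, div_le_iff₀] <;> norm_num [digit] <;> linarith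
    · intro ha
      rw [value_eq, ha, le_div_iff₀] <;> norm_num [digit] <;> linarith
  rw [le_abs]
  cases ha : a 0 <;> cases hb : b 0
  · simp [ha, hb] at h
  · have := (key a).2 ha; have := (key b).1 hb; left; linarith
  · have := (key a).1 ha; have := (key b).2 hb; right; linarith
  · simp [ha, hb] at h

/-! ### Covering numbers and Hausdorff dimension -/

/-- `A` can be covered by at most `c` sets of diameter at most `r`. -/
def CoveredBy (A : Set ℝ) (r c : ℝ) : Prop :=
  ∃ t : Finset (Set ℝ), (t.card : ℝ) ≤ c ∧ A ⊆ ⋃ u ∈ t, u ∧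
    ∀ u ∈ t, ∀ x ∈ u, ∀ y ∈ u, |x - y| ≤ r

lemma CoveredBy.mono {A B : Set ℝ} {r c c' : ℝ} (h : CoveredBy B r c) (hAB : A ⊆ B)
    (hc : c ≤ c') : CoveredBy A r c' := by
  obtain ⟨t, h1, h2, h3⟩ := h
  exact ⟨t, h1.trans hc, hAB.trans h2, h3⟩

lemma coveredBy_one {A : Set ℝ} {r c : ℝ} (h : ∀ x ∈ A, ∀ y ∈ A, |x - y| ≤ r) (hc : 1 ≤ c) :
    CoveredBy A r c :=
  ⟨{A}, by simpa using hc, by simp, by simpa using h⟩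

lemma CoveredBy.biUnion {κ : Type*} {A : Set ℝ} {E : Finset κ} {B : κ → Set ℝ} {r : ℝ} {c : κ → ℝ}
    (h : ∀ e ∈ E, CoveredBy (B e) r (c e)) (hA : A ⊆ ⋃ e ∈ E, B e) :
    CoveredBy A r (∑ e ∈ E, c e) := by
  classical
  choose! t h1 h2 h3 using h
  refine ⟨E.biUnion t, ?_, ?_, ?_⟩
  · calc ((E.biUnion t).card : ℝ) ≤ ((∑ e ∈ E, (t e).card : ℕ) : ℝ) := by
          exact_mod_cast Finset.card_biUnion_le
      _ = ∑ e ∈ E, ((t e).card : ℝ) := by push_cast; rfl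
      _ ≤ _ := Finset.sum_le_sum h1
  · intro x hx
    obtain ⟨e, he, hxe⟩ := Set.mem_iUnion₂.1 (hA hx)
    obtain ⟨u, hu, hxu⟩ := Set.mem_iUnion₂.1 (h2 e he hxe)
    exact Set.mem_iUnion₂.2 ⟨u, Finset.mem_biUnion.2 ⟨e, he, hu⟩, hxu⟩
  · intro u hu
    obtain ⟨e, he, hu⟩ := Finset.mem_biUnion.1 hu
    exact h3 e he u hu

lemma CoveredBy.of_expanding {A B : Set ℝ} {r c k : ℝ} {g : ℝ → ℝ} (h : CoveredBy B r c)
    (hk : 0 ≤ k) (hg : Set.MapsTo g A B)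
    (hgk : ∀ x ∈ A, ∀ y ∈ A, |x - y| ≤ k * |g x - g y|) : CoveredBy A (k * r) c := by
  classical
  obtain ⟨t, h1, h2, h3⟩ := h
  refine ⟨t.image fun u => A ∩ g ⁻¹' u, ?_, ?_, ?_⟩
  · refine le_trans ?_ h1
    exact_mod_cast Finset.card_image_le
  · intro x hx
    obtain ⟨u, hu, hxu⟩ := Set.mem_iUnion₂.1 (h2 (hg hx))
    exact Set.mem_iUnion₂.2 ⟨_, Finset.mem_image_of_mem _ hu, hx, hxu⟩
  · intro w hw x hx y hy
    obtain ⟨u, hu, rfl⟩ := Finset.mem_image.1 hw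
    exact (hgk x hx.1 y hy.1).trans
      (mul_le_mul_of_nonneg_left (h3 u hu _ hx.2 _ hy.2) hk)

lemma CoveredBy.add_add {A : Set ℝ} {r c : ℝ} (h : CoveredBy A r c) (a : ℝ) :
    CoveredBy {z | ∃ x ∈ A, ∃ y ∈ A, z = a + x + y} (2 * r) (c ^ 2) := by
  classical
  obtain ⟨t, h1, h2, h3⟩ := h
  refine ⟨(t ×ˢ t).image fun p => {z | ∃ x ∈ p.1, ∃ y ∈ p.2, z = a + x + y}, ?_, ?_, ?_⟩
  · have e : (((t ×ˢ t).image fun p : Set ℝ × Set ℝ =>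
        {z : ℝ | ∃ x ∈ p.1, ∃ y ∈ p.2, z = a + x + y}).card : ℝ) ≤ (t.card : ℝ) * t.card := by
      rw [← Nat.cast_mul, ← Finset.card_product]
      exact_mod_cast Finset.card_image_le
    nlinarith [Nat.cast_nonneg (α := ℝ) t.card]
  · rintro z ⟨x, hx, y, hy, rfl⟩
    obtain ⟨u, hu, hxu⟩ := Set.mem_iUnion₂.1 (h2 hx)
    obtain ⟨w, hw, hyw⟩ := Set.mem_iUnion₂.1 (h2 hy)
    exact Set.mem_iUnion₂.2 ⟨_, Finset.mem_image_of_mem _ (Finset.mk_mem_product hu hw),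
      x, hxu, y, hyw, rfl⟩
  · intro w hw z hz z' hz'
    obtain ⟨⟨u, u'⟩, hu, rfl⟩ := Finset.mem_image.1 hw
    obtain ⟨hu, hu'⟩ := Finset.mem_product.1 hu
    obtain ⟨x, hx, y, hy, rfl⟩ := hz
    obtain ⟨x', hx', y', hy', rfl⟩ := hz'
    calc |a + x + y - (a + x' + y')| = |(x - x') + (y - y')| := by ring_nf
      _ ≤ |x - x'| + |y - y'| := abs_add_le _ _
      _ ≤ r + r := add_le_add (h3 u hu _ hx _ hx') (h3 u' hu' _ hy _ hy')
      _ = 2 * r := by ring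

lemma _root_.Set.Finite.exists_pos_le {S : Set ℝ} (hS : S.Finite) (h : ∀ x ∈ S, 0 < x) :
    ∃ m, 0 < m ∧ m ≤ 1 ∧ ∀ x ∈ S, m ≤ x := by
  obtain ⟨m, hm, hle⟩ := Set.exists_min_image (insert 1 S) id (hS.insert 1)
    (Set.insert_nonempty _ _)
  refine ⟨m, ?_, hle 1 (Set.mem_insert _ _), fun x hx => hle x (Set.mem_insert_of_mem _ hx)⟩
  rcases hm with rfl | hm
  · exact one_pos
  · exact h m hm

/-- Covering numbers of a finite family of sets, each of which decomposes into finitely many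
pieces that expand into sets of the family. -/
theorem exists_coveredBy_of_expanding {ι κ : Type*} [Finite ι] {A : ι → Set ℝ} {v : ι → ℝ}
    {E : ι → Finset κ} {P : ι → κ → Set ℝ} {T : ι → κ → ι} {k : ι → κ → ℝ} {s : ℝ} (hs : 0 ≤ s)
    (hv : ∀ i, 0 < v i) (hdiam : ∀ i, ∀ x ∈ A i, ∀ y ∈ A i, |x - y| ≤ 1)
    (hk : ∀ i, ∀ e ∈ E i, 0 < k i e ∧ k i e < 1)
    (hsum : ∀ i, ∑ e ∈ E i, k i e ^ s * v (T i e) ≤ v i)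
    (hcov : ∀ i, A i ⊆ ⋃ e ∈ E i, P i e)
    (hexp : ∀ i, ∀ e ∈ E i, ∃ g : ℝ → ℝ, Set.MapsTo g (P i e) (A (T i e)) ∧
      ∀ x ∈ P i e, ∀ y ∈ P i e, |x - y| ≤ k i e * |g x - g y|) :
    ∃ C, ∀ i r, 0 < r → r ≤ 1 → CoveredBy (A i) r (C * v i * r ^ (-s)) := by
  have hfin : (⋃ i, k i '' (E i : Set κ)).Finite :=
    Set.finite_iUnion fun i => (E i).finite_toSet.image _
  obtain ⟨m, hm, hm1, hmk⟩ := hfin.exists_pos_le (by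
    rintro x hx
    obtain ⟨i, e, he, rfl⟩ := Set.mem_iUnion.1 hx
    exact (hk i e he).1)
  replace hmk : ∀ i, ∀ e ∈ E i, m ≤ k i e := fun i e he =>
    hmk _ (Set.mem_iUnion.2 ⟨i, e, he, rfl⟩)
  obtain ⟨δ, hδ, hδ1, hδk⟩ := (hfin.image fun x => 1 - x).exists_pos_le (by
    rintro x ⟨y, hy, rfl⟩
    obtain ⟨i, e, he, rfl⟩ := Set.mem_iUnion.1 hy
    have := (hk i e he).2
    simp only
    linarith)
  replace hδk : ∀ i, ∀ e ∈ E i, k i e ≤ 1 - δ / 2 := fun i e he => by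
    have := hδk _ ⟨_, Set.mem_iUnion.2 ⟨i, e, he, rfl⟩, rfl⟩
    linarith
  obtain ⟨v₀, hv₀, -, hv₀v⟩ := (Set.finite_range v).exists_pos_le (by rintro _ ⟨i, rfl⟩; exact hv i)
  replace hv₀v : ∀ i, v₀ ≤ v i := fun i => hv₀v _ ⟨i, rfl⟩
  set ρ := 1 - δ / 2
  have hρ : 0 < ρ := by simp only [ρ]; linarith
  have hρ1 : ρ < 1 := by simp only [ρ]; linarith
  have hms : 0 < m ^ s := Real.rpow_pos_of_pos hm s
  set C := 1 / (v₀ * m ^ s) with hC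
  have hC0 : 0 < C := by positivity
  have base : ∀ i r, 1 ≤ r → r ≤ 1 / m → CoveredBy (A i) r (C * v i * r ^ (-s)) := by
    intro i r h1 h2
    refine coveredBy_one (fun x hx y hy => (hdiam i x hx y hy).trans h1) ?_
    have h3 : m ^ s ≤ r ^ (-s) := by
      have := Real.rpow_le_rpow_of_nonpos (by linarith : 0 < r) h2 (neg_nonpos.2 hs)
      rwa [one_div, Real.inv_rpow hm.le, Real.rpow_neg hm.le, inv_inv] at this
    calc 1 = C * v₀ * m ^ s := by rw [hC]; field_simp
      _ ≤ C * v i * r ^ (-s) := by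
        have := hv₀v i
        have := hv i
        gcongr
  have main : ∀ n : ℕ, ∀ i r, ρ ^ n ≤ r → r ≤ 1 / m → CoveredBy (A i) r (C * v i * r ^ (-s)) := by
    intro n
    induction n with
    | zero => intro i r h1 h2; exact base i r (by simpa using h1) h2
    | succ n ih =>
      intro i r h1 h2
      have hr : 0 < r := lt_of_lt_of_le (by positivity) h1
      rcases le_or_gt 1 r with hr1 | hr1
      · exact base i r hr1 h2
      · have step : ∀ e ∈ E i, CoveredBy (P i e) r (C * v (T i e) * (r / k i e) ^ (-s)) := by
          intro e he
          have hke := (hk i e he).1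
          obtain ⟨g, hg, hgk⟩ := hexp i e he
          have := (ih (T i e) (r / k i e) (by
            rw [le_div_iff₀ hke]
            calc ρ ^ n * k i e ≤ ρ ^ n * ρ := by have := hδk i e he; gcongr
              _ ≤ r := by rw [← pow_succ]; exact h1) (by
            have := hmk i e he
            gcongr)).of_expanding hke.le hg hgk
          rwa [mul_div_cancel₀ _ hke.ne'] at this
        refine (CoveredBy.biUnion step (hcov i)).mono subset_rfl ?_
        calc ∑ e ∈ E i, C * v (T i e) * (r / k i e) ^ (-s)
            = C * r ^ (-s) * ∑ e ∈ E i, k i e ^ s * v (T i e) := by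
              rw [Finset.mul_sum]
              refine Finset.sum_congr rfl fun e he => ?_
              have hke := (hk i e he).1
              rw [Real.div_rpow hr.le hke.le, Real.rpow_neg hke.le, div_inv_eq_mul]
              ring
          _ ≤ C * r ^ (-s) * v i := by have := hsum i; gcongr
          _ = _ := by ring
  refine ⟨C, fun i r hr hr1 => ?_⟩
  obtain ⟨n, hn⟩ := exists_pow_lt_of_lt_one hr hρ1
  exact main n i r hn.le (hr1.trans (by rw [le_div_iff₀ hm]; linarith))

lemma dimH_le_of_coveredBy {A : Set ℝ} {s : NNReal} {C : ℝ}
    (h : ∀ r, 0 < r → r ≤ 1 → CoveredBy A r (C * r ^ (-(s : ℝ)))) : dimH A ≤ s := by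
  have hr : ∀ n : ℕ, (0 : ℝ) < 1 / ((n : ℝ) + 1) ∧ 1 / ((n : ℝ) + 1) ≤ 1 := fun n =>
    ⟨by positivity, by rw [div_le_one (by positivity)]; linarith [Nat.cast_nonneg (α := ℝ) n]⟩
  choose t h1 h2 h3 using fun n : ℕ => h _ (hr n).1 (hr n).2
  have hdiam : ∀ n, ∀ u : t n, Metric.ediam (u : Set ℝ) ≤ ENNReal.ofReal (1 / ((n : ℝ) + 1)) := by
    intro n u
    refine Metric.ediam_le fun x hx y hy => ?_
    rw [edist_dist, Real.dist_eq]
    exact ENNReal.ofReal_le_ofReal (h3 n u u.2 x hx y hy)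
  refine dimH_le_of_hausdorffMeasure_ne_top (ne_top_of_le_ne_top (b := ENNReal.ofReal C) (by simp) ?_)
  refine (MeasureTheory.Measure.hausdorffMeasure_le_liminf_sum (β := ℕ) (l := atTop)
    (ι := fun n => t n) (s : ℝ) A (fun n => ENNReal.ofReal (1 / ((n : ℝ) + 1))) ?_
    (fun n u => (u : Set ℝ)) (Eventually.of_forall hdiam) (Eventually.of_forall fun n => ?_)).trans ?_
  · have := ENNReal.tendsto_ofReal tendsto_one_div_add_atTop_nhds_zero_nat
    simpa using this
  · intro x hx
    obtain ⟨u, hu, hxu⟩ := Set.mem_iUnion₂.1 (h2 n hx)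
    exact Set.mem_iUnion.2 ⟨⟨u, hu⟩, hxu⟩
  · refine liminf_le_of_frequently_le' (Frequently.of_forall fun n => ?_)
    have hrn := (hr n).1
    calc ∑ u : t n, Metric.ediam (u : Set ℝ) ^ (s : ℝ)
        ≤ ∑ u : t n, ENNReal.ofReal ((1 / ((n : ℝ) + 1)) ^ (s : ℝ)) := by
          refine Finset.sum_le_sum fun u _ => ?_
          rw [← ENNReal.ofReal_rpow_of_nonneg hrn.le s.coe_nonneg]
          exact ENNReal.rpow_le_rpow (hdiam n u) s.coe_nonneg
      _ = ENNReal.ofReal ((t n).card * (1 / ((n : ℝ) + 1)) ^ (s : ℝ)) := by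
          rw [Finset.sum_const, Finset.card_univ, Fintype.card_coe, nsmul_eq_mul,
            ENNReal.ofReal_mul (by positivity), ENNReal.ofReal_natCast]
      _ ≤ ENNReal.ofReal C := by
          refine ENNReal.ofReal_le_ofReal ?_
          calc _ ≤ C * (1 / ((n : ℝ) + 1)) ^ (-(s : ℝ)) * (1 / ((n : ℝ) + 1)) ^ (s : ℝ) := by
                have := h1 n
                gcongr
            _ = C := by rw [mul_assoc, ← Real.rpow_add hrn]; simp

/-- A compact set of dimension less than `s` has a finite cover with small `s`-dimensional cost. -/
lemma exists_finite_cover_of_dimH_lt {K : Set ℝ} (hK : IsCompact K) {s : NNReal} (hs : dimH K < s)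
    {c : ℝ} (hc : 0 < c) :
    ∃ (F : Finset ℕ) (U : ℕ → Set ℝ) (R : ℕ → ℝ), (∀ n, 0 < R n) ∧ K ⊆ ⋃ n ∈ F, U n ∧
      (∀ n, ∀ x ∈ U n, ∀ y ∈ U n, |x - y| ≤ R n) ∧ ∑ n ∈ F, (c * R n) ^ (s : ℝ) < 1 := by
  have hs0 : (0 : ℝ) < s := by
    have : (0 : ENNReal) < s := lt_of_le_of_lt zero_le hs
    exact_mod_cast this
  have hcs : 0 < c ^ (s : ℝ) := Real.rpow_pos_of_pos hc _
  set δ : ℝ := 1 / (2 * c ^ (s : ℝ)) with hδ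
  have hδ0 : 0 < δ := by positivity
  have hμ := hausdorffMeasure_of_dimH_lt hs
  rw [MeasureTheory.Measure.hausdorffMeasure_apply] at hμ
  have h1 := le_iSup₂ (f := fun (r : ENNReal) (_ : 0 < r) =>
    ⨅ (t : ℕ → Set ℝ) (_ : K ⊆ ⋃ n, t n) (_ : ∀ n, Metric.ediam (t n) ≤ r),
      ∑' n, ⨆ _ : (t n).Nonempty, Metric.ediam (t n) ^ (s : ℝ)) 1 one_pos
  rw [hμ] at h1
  have h2 := lt_of_le_of_lt h1 (ENNReal.ofReal_pos.2 hδ0)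
  simp only [iInf_lt_iff] at h2
  obtain ⟨t, hKt, htd, hsum⟩ := h2
  set d : ℕ → ℝ := fun n => (Metric.ediam (t n)).toReal with hd
  have hfin : ∀ n, Metric.ediam (t n) ≠ ⊤ := fun n => ne_top_of_le_ne_top ENNReal.one_ne_top (htd n)
  have hd0 : ∀ n, 0 ≤ d n := fun n => ENNReal.toReal_nonneg
  have hterm : ∀ n, ENNReal.ofReal (d n ^ (s : ℝ)) ≤
      ⨆ _ : (t n).Nonempty, Metric.ediam (t n) ^ (s : ℝ) := by
    intro n
    rcases (t n).eq_empty_or_nonempty with he | hne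
    · simp [hd, he, Real.zero_rpow hs0.ne']
    · rw [← ENNReal.ofReal_rpow_of_nonneg (hd0 n) hs0.le, ENNReal.ofReal_toReal (hfin n)]
      exact le_iSup (fun _ : (t n).Nonempty => Metric.ediam (t n) ^ (s : ℝ)) hne
  obtain ⟨ε, hε, Sε, hεs, hεδ⟩ := posSumOfEncodable hδ0 ℕ
  have hη : ∀ n, ∃ η : ℝ, 0 < η ∧ (d n + 2 * η) ^ (s : ℝ) < d n ^ (s : ℝ) + ε n := by
    intro n
    have hcont : Continuous fun x : ℝ => (d n + 2 * x) ^ (s : ℝ) :=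
      (Real.continuous_rpow_const hs0.le).comp (by fun_prop)
    have hev : ∀ᶠ x in nhdsWithin (0 : ℝ) (Set.Ioi 0),
        (d n + 2 * x) ^ (s : ℝ) < d n ^ (s : ℝ) + ε n := by
      refine (hcont.tendsto 0).mono_left nhdsWithin_le_nhds |>.eventually (gt_mem_nhds ?_)
      simpa using hε n
    obtain ⟨x, hx, hx0⟩ := (hev.and self_mem_nhdsWithin).exists
    exact ⟨x, hx0, hx⟩
  choose η hη0 hη using hη
  have hR0 : ∀ n, 0 < d n + 2 * η n := fun n => by linarith [hd0 n, hη0 n]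
  obtain ⟨F, hF⟩ := hK.elim_finite_subcover (fun n => Metric.thickening (η n) (t n))
    (fun n => Metric.isOpen_thickening) (hKt.trans
      (Set.iUnion_mono fun n => Metric.self_subset_thickening (hη0 n) _))
  refine ⟨F, fun n => Metric.thickening (η n) (t n), fun n => d n + 2 * η n, hR0, hF, ?_, ?_⟩
  · intro n x hx y hy
    obtain ⟨x', hx', hxx⟩ := Metric.mem_thickening_iff.1 hx
    obtain ⟨y', hy', hyy⟩ := Metric.mem_thickening_iff.1 hy
    have h3 : dist x' y' ≤ d n := by
      rw [dist_edist]
      exact ENNReal.toReal_mono (hfin n) (Metric.edist_le_ediam_of_mem hx' hy')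
    rw [← Real.dist_eq]
    have h4 := dist_triangle4 x x' y' y
    rw [dist_comm y' y] at h4
    linarith
  · have h5 : ∑ n ∈ F, d n ^ (s : ℝ) < δ := by
      rw [← ENNReal.ofReal_lt_ofReal_iff hδ0, ENNReal.ofReal_sum_of_nonneg fun n _ =>
        Real.rpow_nonneg (hd0 n) _]
      exact ((Finset.sum_le_sum fun n _ => hterm n).trans (ENNReal.sum_le_tsum F)).trans_lt hsum
    have h6 : ∑ n ∈ F, ε n ≤ δ := (sum_le_hasSum F (fun n _ => (hε n).le) hεs).trans hεδ
    calc ∑ n ∈ F, (c * (d n + 2 * η n)) ^ (s : ℝ)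
        = c ^ (s : ℝ) * ∑ n ∈ F, (d n + 2 * η n) ^ (s : ℝ) := by
          rw [Finset.mul_sum]
          exact Finset.sum_congr rfl fun n _ => Real.mul_rpow hc.le (hR0 n).le
      _ ≤ c ^ (s : ℝ) * ∑ n ∈ F, (d n ^ (s : ℝ) + ε n) := by
          gcongr with n
          exact (hη n).le
      _ < c ^ (s : ℝ) * (δ + δ) := by
          rw [Finset.sum_add_distrib]
          exact mul_lt_mul_of_pos_left (by linarith) hcs
      _ = 1 := by rw [hδ]; field_simp; norm_num

/-- If every small piece of a compact set expands into the whole set with bounded distortion, then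
the sumset of the set with itself has at most twice its dimension. -/
theorem dimH_add_add_le {K : Set ℝ} (hK : IsCompact K) (hdiam : ∀ x ∈ K, ∀ y ∈ K, |x - y| ≤ 1)
    {c : ℝ} (hc : 0 < c)
    (hexp : ∀ B ⊆ K, ∀ R, (∀ x ∈ B, ∀ y ∈ B, |x - y| ≤ R) → ∃ g : ℝ → ℝ, Set.MapsTo g B K ∧
      ∀ x ∈ B, ∀ y ∈ B, |x - y| ≤ c * R * |g x - g y|) (a : ℝ) :
    dimH {z | ∃ x ∈ K, ∃ y ∈ K, z = a + x + y} ≤ 2 * dimH K := by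
  have key : ∀ s : NNReal, dimH K < s →
      dimH {z | ∃ x ∈ K, ∃ y ∈ K, z = a + x + y} ≤ (2 * s : NNReal) := by
    intro s hs
    obtain ⟨F, U, R, hR, hKU, hUR, hsum⟩ := exists_finite_cover_of_dimH_lt hK hs hc
    have hk : ∀ n, 0 < c * R n := fun n => mul_pos hc (hR n)
    obtain ⟨C, hC⟩ := exists_coveredBy_of_expanding (ι := Unit) (κ := ℕ) (A := fun _ => K)
      (v := fun _ => 1) (E := fun _ => F) (P := fun _ n => K ∩ U n) (T := fun _ _ => ())
      (k := fun _ n => c * R n) (s := s) s.coe_nonneg (fun _ => one_pos) (fun _ => hdiam)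
      (fun _ n hn => ⟨hk n, by
        by_contra! h
        have h1 := Finset.single_le_sum (f := fun n => (c * R n) ^ (s : ℝ))
          (fun n _ => Real.rpow_nonneg (hk n).le _) hn
        have h2 := Real.one_le_rpow h s.coe_nonneg
        linarith⟩)
      (fun _ => by simpa using hsum.le)
      (fun _ x hx => by
        obtain ⟨n, hn, hxn⟩ := Set.mem_iUnion₂.1 (hKU hx)
        exact Set.mem_iUnion₂.2 ⟨n, hn, hx, hxn⟩)
      (fun _ n _ => hexp _ Set.inter_subset_left _ fun x hx y hy => hUR n x hx.2 y hy.2)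
    refine dimH_le_of_coveredBy (C := (C * 2 ^ (s : ℝ)) ^ 2) fun r hr hr1 => ?_
    have h := ((hC () (r / 2) (by linarith) (by linarith)).add_add a)
    rw [mul_div_cancel₀ r two_ne_zero] at h
    refine h.mono subset_rfl (le_of_eq ?_)
    rw [Real.div_rpow hr.le two_pos.le, Real.rpow_neg two_pos.le, div_inv_eq_mul]
    have : r ^ (-((2 * s : NNReal) : ℝ)) = (r ^ (-(s : ℝ))) ^ 2 := by
      rw [← Real.rpow_natCast, ← Real.rpow_mul hr.le]
      congr 1
      push_cast
      ring
    rw [this]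
    ring
  by_contra! hlt
  have h1 : dimH K < dimH {z | ∃ x ∈ K, ∃ y ∈ K, z = a + x + y} / 2 := by
    rw [ENNReal.lt_div_iff_mul_lt (by simp) (by simp), mul_comm]
    exact hlt
  obtain ⟨s, hs1, hs2⟩ := ENNReal.lt_iff_exists_nnreal_btwn.1 h1
  have h2 := key s hs1
  rw [ENNReal.lt_div_iff_mul_lt (by simp) (by simp), mul_comm] at hs2
  push_cast at h2
  exact absurd h2 (not_le.2 hs2)

/-! ### The Gauss–Cantor set as the image of a subshift -/

/-- The sequences avoiding the words of `forbiddenC1`. -/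
def admissible : Set (ℕ → Bool) :=
  {a | ∀ w ∈ forbiddenC1, ∀ i, ¬ occursAtN (fun n => digit (a n)) i w}

lemma tail_mem_admissible {a : ℕ → Bool} (ha : a ∈ admissible) : tail a ∈ admissible := by
  intro w hw i h
  refine ha w hw (i + 1) fun j hj => ?_
  have := h j hj
  simp only [tail] at this
  rw [← this, add_right_comm]

lemma isClosed_admissible : IsClosed admissible := by
  have : admissible = ⋂ w ∈ forbiddenC1, ⋂ i,
      {a | occursAtN (fun n => digit (a n)) i w}ᶜ := by
    ext a; simp [admissible]
  rw [this]
  refine isClosed_iInter fun w => isClosed_iInter fun _ => isClosed_iInter fun i => ?_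
  rw [isClosed_compl_iff]
  have : {a : ℕ → Bool | occursAtN (fun n => digit (a n)) i w} =
      ⋂ j ∈ Set.Iio w.length, (fun a : ℕ → Bool => a (i + j)) ⁻¹' {b | digit b = w.getD j 0} := by
    ext a; simp [occursAtN]
  rw [this]
  exact (Set.finite_Iio _).isOpen_biInter fun j _ =>
    (isOpen_discrete _).preimage (continuous_apply (i + j))

lemma digit_decide {n : ℕ} (h : n ∈ ({1, 2} : Set ℕ)) : digit (decide (n = 2)) = n := by
  rcases h with rfl | h
  · rfl
  · rw [Set.mem_singleton_iff] at h
    subst h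
    rfl

lemma gaussCantor_eq : gaussCantor {1, 2} forbiddenC1 = value '' admissible := by
  ext x
  constructor
  · rintro ⟨a, ha, hF, rfl⟩
    have e : (fun n => digit (decide (a n = 2))) = a := funext fun n => digit_decide (ha n)
    refine ⟨fun n => decide (a n = 2), ?_, ?_⟩
    · intro w hw i
      rw [e]
      exact hF w hw i
    · rw [value, e]
  · rintro ⟨a, ha, rfl⟩
    refine ⟨fun n => digit (a n), fun n => ?_, ha, rfl⟩
    cases a n <;> simp [digit]

/-- Small pieces of the image of a subshift expand into the whole image with bounded
distortion. -/
lemma exists_expanding {S : Set (ℕ → Bool)} (hS : ∀ a ∈ S, tail a ∈ S) {B : Set ℝ}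
    (hB : B ⊆ value '' S) {R : ℝ} (hR : ∀ x ∈ B, ∀ y ∈ B, |x - y| ≤ R) :
    ∃ g : ℝ → ℝ, Set.MapsTo g B (value '' S) ∧
      ∀ x ∈ B, ∀ y ∈ B, |x - y| ≤ 40 * R * |g x - g y| := by
  classical
  by_cases hsub : B.Subsingleton
  · exact ⟨id, hB, fun x hx y hy => by simp [hsub hx hy]⟩
  have hex : ∀ x, ∃ a, x ∈ B → a ∈ S ∧ value a = x := fun x => by
    by_cases hx : x ∈ B
    · obtain ⟨a, ha⟩ := hB hx
      exact ⟨a, fun _ => ha⟩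
    · exact ⟨fun _ => true, fun h => absurd h hx⟩
  choose f hf using hex
  have hne : ∃ n, ∃ x ∈ B, ∃ y ∈ B, f x n ≠ f y n := by
    rw [Set.not_subsingleton_iff] at hsub
    obtain ⟨x, hx, y, hy, hxy⟩ := hsub
    have : f x ≠ f y := fun h => hxy (by rw [← (hf x hx).2, ← (hf y hy).2, h])
    obtain ⟨n, hn⟩ := Function.ne_iff.1 this
    exact ⟨n, x, hx, y, hy, hn⟩
  set n := Nat.find hne
  obtain ⟨x₀, hx₀, y₀, hy₀, hn⟩ := Nat.find_spec hne
  have hagree : ∀ x ∈ B, ∀ y ∈ B, ∀ i < n, f x i = f y i := by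
    intro x hx y hy i hi
    by_contra h
    exact Nat.find_min hne hi ⟨x, hx, y, hy, h⟩
  have hiter : ∀ (m : ℕ), ∀ a ∈ S, tail^[m] a ∈ S := by
    intro m
    induction m with
    | zero => exact fun a ha => ha
    | succ m ih => intro a ha; rw [Function.iterate_succ_apply]; exact ih _ (hS a ha)
  refine ⟨fun x => value (tail^[n] (f x)), fun x hx => ⟨_, hiter n _ (hf x hx).1, rfl⟩, ?_⟩
  intro x hx y hy
  have h0 := hR x₀ hx₀ y₀ hy₀
  have e0 := abs_value_sub_of_agree (hagree x₀ hx₀ y₀ hy₀)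
  have e := abs_value_sub_of_agree (hagree x hx y hy)
  rw [(hf x₀ hx₀).2, (hf y₀ hy₀).2] at e0
  rw [(hf x hx).2, (hf y hy).2] at e
  have h1 : 0.1 ≤ |value (tail^[n] (f x₀)) - value (tail^[n] (f y₀))| :=
    le_abs_value_sub_of_head_ne (by rw [tail_iterate, tail_iterate, zero_add]; exact hn)
  have h2 := tailProd_le_two_mul (hagree x hx x₀ hx₀)
  have h3 := tailProd_le_two_mul (hagree y hy y₀ hy₀)
  have p1 := tailProd_pos n (f x)
  have p2 := tailProd_pos n (f y)
  have p3 := tailProd_pos n (f x₀)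
  have p4 := tailProd_pos n (f y₀)
  rw [e]
  refine mul_le_mul_of_nonneg_right ?_ (abs_nonneg _)
  have h4 : tailProd n (f x₀) * tailProd n (f y₀) * 0.1 ≤ R :=
    (mul_le_mul_of_nonneg_left h1 (by positivity)).trans (e0 ▸ h0)
  calc tailProd n (f x) * tailProd n (f y)
      ≤ (2 * tailProd n (f x₀)) * (2 * tailProd n (f y₀)) := by gcongr
    _ ≤ 40 * R := by linarith

/-! ### Markov values at most `3.042` -/

/-- The value `λ₀` for bi-infinite sequences of partial quotients encoded by booleans. -/
noncomputable def lam (β : ℤ → Bool) : ℝ :=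
  digit (β 0) + value (fun n => β (n + 1)) + value fun n => β (-(n + 1))

/-- The shift of a bi-infinite sequence. -/
def shift {α : Type*} (n : ℤ) (β : ℤ → α) : ℤ → α := fun i => β (i + n)

lemma lambda0_eq {α : ℤ → ℕ} (hα : ∀ i, 1 ≤ α i) :
    lambda0 α = α 0 + cf01 (fun n : ℕ => α (n + 1)) + cf01 (fun n : ℕ => α (-(n + 1))) := by
  rw [lambda0, cfVal_eq (a := fun n : ℕ => α n) fun n => hα _]
  have h : tail (fun n : ℕ => α n) = fun n : ℕ => α (n + 1) := funext fun n => by simp [tail]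
  rw [h]
  rfl

lemma lambda0_digit (β : ℤ → Bool) : lambda0 (fun i => digit (β i)) = lam β :=
  lambda0_eq fun _ => one_le_digit _

lemma continuous_lam : Continuous lam := by
  have h : Continuous fun b : Bool => (digit b : ℝ) := continuous_of_discreteTopology
  refine ((h.comp (continuous_apply 0)).add (continuous_value.comp ?_)).add
    (continuous_value.comp ?_)
  · exact continuous_pi fun n => continuous_apply _
  · exact continuous_pi fun n => continuous_apply _

lemma value_bounds {a : ℕ → Bool} {b : Bool} {l h : ℝ} (ha : a 0 = b) (hl0 : 0 ≤ l)
    (hl : l ≤ value (tail a)) (hh : value (tail a) ≤ h) :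
    1 / (digit b + h) ≤ value a ∧ value a ≤ 1 / (digit b + l) := by
  have h1 : (1 : ℝ) ≤ digit b := by exact_mod_cast one_le_digit _
  rw [value_eq a, ha]
  constructor
  · apply one_div_le_one_div_of_le <;> linarith
  · apply one_div_le_one_div_of_le <;> linarith

lemma le_value_of_one {a : ℕ → Bool} (h0 : a 0 = false) : 0.577 ≤ value a := by
  have h := value_mem (tail a)
  refine le_trans ?_ (value_bounds h0 (by norm_num) h.1 h.2).1
  norm_num [digit]

lemma value_mem_of_two {a : ℕ → Bool} (h0 : a 0 = true) : 0.366 ≤ value a ∧ value a ≤ 0.42266 := by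
  have h := value_mem (tail a)
  refine ⟨(value_mem a).1, (value_bounds h0 (by norm_num) h.1 h.2).2.trans ?_⟩
  norm_num [digit]

lemma value_mem_of_one_two {a : ℕ → Bool} (h0 : a 0 = false) (h1 : a 1 = true) :
    0.7029 ≤ value a ∧ value a ≤ 0.7321 := by
  have h := value_mem_of_two (a := tail a) h1
  refine ⟨le_trans ?_ (value_bounds h0 (by norm_num) h.1 h.2).1, (value_mem a).2⟩
  norm_num [digit]

lemma le_value_of_two_two {a : ℕ → Bool} (h0 : a 0 = true) (h1 : a 1 = true) :
    0.4127 ≤ value a := by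
  have h := value_mem_of_two (a := tail a) h1
  refine le_trans ?_ (value_bounds h0 (by norm_num) h.1 h.2).1
  norm_num [digit]

lemma le_value_of_one_one_one_two {a : ℕ → Bool} (h0 : a 0 = false) (h1 : a 1 = false)
    (h2 : a 2 = false) (h3 : a 3 = true) : 0.63 ≤ value a := by
  have k2 := value_mem_of_one_two (a := tail (tail a)) h2 h3
  have k1 := value_bounds (a := tail a) h1 (by norm_num) k2.1 k2.2
  refine le_trans ?_ (value_bounds h0 (by positivity) k1.1 k1.2).1
  norm_num [digit]

lemma digit_eq_one {b : Bool} (h : digit b = 1) : b = false := by cases b <;> simp_all [digit]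

lemma digit_eq_two {b : Bool} (h : digit b = 2) : b = true := by cases b <;> simp_all [digit]

lemma forward_mem_admissible {β : ℤ → Bool} (h : ∀ n, lam (shift n β) ≤ 3.042) :
    (fun n : ℕ => β (n + 1)) ∈ admissible := by
  have lam_eq : ∀ c : ℤ, β c = true → lam (shift c β) =
      2 + value (fun n => β (n + 1 + c)) + value (fun n => β (-(n + 1) + c)) := by
    intro c hc
    simp [lam, shift, hc, digit]
  intro w hw i hocc
  simp only [forbiddenC1, List.mem_cons, List.not_mem_nil, or_false] at hw
  rcases hw with rfl | rfl | rfl | rfl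
  · have w0 := digit_eq_one (hocc 0 (by simp))
    have w1 := digit_eq_two (hocc 1 (by simp))
    have w2 := digit_eq_one (hocc 2 (by simp))
    have hc := h (i + 2)
    rw [lam_eq (i + 2) (by rw [← w1]; congr 1)] at hc
    have k1 := le_value_of_one (a := fun n => β (n + 1 + ((i : ℤ) + 2)))
      (by rw [← w2]; congr 1; push_cast; ring)
    have k2 := le_value_of_one (a := fun n => β (-(n + 1) + ((i : ℤ) + 2)))
      (by rw [← w0]; congr 1; push_cast; ring)
    linarith
  · have w0 := digit_eq_two (hocc 0 (by simp))
    have w1 := digit_eq_one (hocc 1 (by simp))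
    have w2 := digit_eq_two (hocc 2 (by simp))
    have hc := h (i + 1)
    rw [lam_eq (i + 1) (by rw [← w0]; congr 1)] at hc
    have k1 := (value_mem_of_one_two (a := fun n => β (n + 1 + ((i : ℤ) + 1)))
      (by rw [← w1]; congr 1; push_cast; ring) (by rw [← w2]; congr 1; push_cast; ring)).1
    have k2 := (value_mem fun n => β (-(n + 1) + ((i : ℤ) + 1))).1
    linarith
  · have w0 := digit_eq_two (hocc 0 (by simp))
    have w1 := digit_eq_one (hocc 1 (by simp))
    have w2 := digit_eq_one (hocc 2 (by simp))
    have w3 := digit_eq_one (hocc 3 (by simp))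
    have w4 := digit_eq_two (hocc 4 (by simp))
    have w5 := digit_eq_two (hocc 5 (by simp))
    have w6 := digit_eq_two (hocc 6 (by simp))
    have hc := h (i + 5)
    rw [lam_eq (i + 5) (by rw [← w4]; congr 1)] at hc
    have k1 := le_value_of_two_two (a := fun n => β (n + 1 + ((i : ℤ) + 5)))
      (by rw [← w5]; congr 1; push_cast; ring) (by rw [← w6]; congr 1; push_cast; ring)
    have k2 := le_value_of_one_one_one_two (a := fun n => β (-(n + 1) + ((i : ℤ) + 5)))
      (by rw [← w3]; congr 1; push_cast; ring) (by rw [← w2]; congr 1; push_cast; ring)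
      (by rw [← w1]; congr 1; push_cast; ring) (by rw [← w0]; congr 1; push_cast; ring)
    linarith
  · have w0 := digit_eq_two (hocc 0 (by simp))
    have w1 := digit_eq_two (hocc 1 (by simp))
    have w2 := digit_eq_two (hocc 2 (by simp))
    have w3 := digit_eq_one (hocc 3 (by simp))
    have w4 := digit_eq_one (hocc 4 (by simp))
    have w5 := digit_eq_one (hocc 5 (by simp))
    have w6 := digit_eq_two (hocc 6 (by simp))
    have hc := h (i + 3)
    rw [lam_eq (i + 3) (by rw [← w2]; congr 1)] at hc
    have k1 := le_value_of_two_two (a := fun n => β (-(n + 1) + ((i : ℤ) + 3)))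
      (by rw [← w1]; congr 1; push_cast; ring) (by rw [← w0]; congr 1; push_cast; ring)
    have k2 := le_value_of_one_one_one_two (a := fun n => β (n + 1 + ((i : ℤ) + 3)))
      (by rw [← w3]; congr 1; push_cast; ring) (by rw [← w4]; congr 1; push_cast; ring)
      (by rw [← w5]; congr 1; push_cast; ring) (by rw [← w6]; congr 1; push_cast; ring)
    linarith

lemma backward_mem_admissible {β : ℤ → Bool} (h : ∀ n, lam (shift n β) ≤ 3.042) :
    (fun n : ℕ => β (-(n + 1))) ∈ admissible := by
  refine forward_mem_admissible (β := fun i => β (-i)) fun n => ?_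
  refine le_of_eq_of_le ?_ (h (-n))
  simp only [lam, shift]
  rw [add_right_comm]
  congr 2
  · congr 3
    ring_nf
  · congr 2
    funext m
    congr 1
    ring
  · funext m
    congr 1
    ring

/-- A Markov value is attained at the origin by some sequence with the same upper bound. -/
lemma exists_lam_eq_iSup (α : ℤ → Bool) {x : ℝ} (hx : ∀ n, lam (shift n α) ≤ x)
    (hsup : ⨆ n, lam (shift n α) = x) :
    ∃ β, lam β = x ∧ ∀ n, lam (shift n β) ≤ x := by
  set T : Set (ℤ → Bool) := {β | ∀ n, lam (shift n β) ≤ x} with hT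
  have hclosed : IsClosed T := by
    have h : T = ⋂ n, {β | lam (shift n β) ≤ x} := by ext β; simp [hT]
    rw [h]
    refine isClosed_iInter fun n => isClosed_le (continuous_lam.comp ?_) continuous_const
    exact continuous_pi fun i => continuous_apply _
  have hshift : ∀ m n : ℤ, shift n (shift m α) = shift (n + m) α := fun m n => by
    funext i
    simp only [shift]
    rw [add_assoc]
  have hmem : ∀ m, shift m α ∈ T := fun m n => by rw [hshift]; exact hx _
  obtain ⟨β, hβ, hmax⟩ := hclosed.isCompact.exists_isMaxOn ⟨_, hmem 0⟩ continuous_lam.continuousOn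
  refine ⟨β, le_antisymm ?_ ?_, hβ⟩
  · have e : shift 0 β = β := funext fun i => by simp [shift]
    have := hβ 0
    rwa [e] at this
  · rw [← hsup]
    exact ciSup_le fun n => hmax (hmem n)

lemma lam_const_false : lam (fun _ => false) = √5 := by
  have h1 := value_eq fun _ => false
  have h2 : tail (fun _ : ℕ => false) = fun _ => false := rfl
  rw [h2] at h1
  have hp := value_pos fun _ => false
  simp only [lam]
  set v := value fun _ => false
  simp only [digit] at h1 ⊢
  norm_num at h1 ⊢
  rw [eq_comm, Real.sqrt_eq_iff_mul_self_eq (by norm_num) (by positivity)]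
  have h3 : v * (1 + v) = 1 := by
    nth_rewrite 1 [h1]
    exact inv_mul_cancel₀ (by positivity)
  nlinarith

lemma markov_subset : MarkovSpectrum ∩ Set.Ioc (√5) 3.042 ⊆
    {z | ∃ x ∈ value '' admissible, ∃ y ∈ value '' admissible, z = 2 + x + y} := by
  rintro x ⟨⟨α, hα, hm⟩, hx5, hx⟩
  have hα' : ∀ n i, 1 ≤ shiftZ n α i := fun n i => hα _
  have hbdd : BddAbove (Set.range fun n : ℤ => lambda0 (shiftZ n α)) := by
    by_contra h
    rw [markovValue, Real.iSup_of_not_bddAbove h] at hm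
    have := Real.sqrt_nonneg 5
    linarith
  have hle : ∀ n, lambda0 (shiftZ n α) ≤ x := fun n => hm ▸ le_ciSup hbdd n
  have hdig : ∀ n, α n ∈ ({1, 2} : Set ℕ) := by
    intro n
    have h1 := (hle n).trans hx
    rw [lambda0_eq (hα' n)] at h1
    have hz : shiftZ n α 0 = α n := by simp [shiftZ]
    rw [hz] at h1
    have hlow : ∀ a : ℕ → ℕ, (∀ i, 1 ≤ a i) → a 0 ≤ 3 → 1 / 4 ≤ cf01 a := by
      intro a ha h3
      have h3 : (a 0 : ℝ) ≤ 3 := by exact_mod_cast h3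
      have h0 : (1 : ℝ) ≤ a 0 := by exact_mod_cast ha 0
      have := cf01_mem (a := tail a) fun _ => ha _
      rw [cf01_eq ha]
      apply one_div_le_one_div_of_le <;> linarith
    have h3 : ∀ n, α n ≤ 3 := by
      intro n
      have h1 := (hle n).trans hx
      rw [lambda0_eq (hα' n)] at h1
      have hz : shiftZ n α 0 = α n := by simp [shiftZ]
      rw [hz] at h1
      have k1 := (cf01_mem (a := fun m : ℕ => shiftZ n α (m + 1)) fun _ => hα _).1
      have k2 := (cf01_mem (a := fun m : ℕ => shiftZ n α (-(m + 1))) fun _ => hα _).1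
      have : (α n : ℝ) < 4 := by linarith
      have : α n < 4 := by exact_mod_cast this
      omega
    have k1 := hlow (fun m : ℕ => shiftZ n α (m + 1)) (fun _ => hα _) (h3 _)
    have k2 := hlow (fun m : ℕ => shiftZ n α (-(m + 1))) (fun _ => hα _) (h3 _)
    have h4 : (α n : ℝ) < 3 := by linarith
    have h5 : α n < 3 := by exact_mod_cast h4
    have := hα n
    simp only [Set.mem_insert_iff, Set.mem_singleton_iff]
    omega
  set b : ℤ → Bool := fun i => decide (α i = 2) with hb
  have hlam : ∀ n, lambda0 (shiftZ n α) = lam (shift n b) := by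
    intro n
    rw [← lambda0_digit]
    congr 1
    funext i
    exact (digit_decide (hdig _)).symm
  have hle' : ∀ n, lam (shift n b) ≤ x := fun n => hlam n ▸ hle n
  have hsup : ⨆ n, lam (shift n b) = x := by
    rw [← hm, markovValue]
    simp only [hlam]
  obtain ⟨β, hβ, hβx⟩ := exists_lam_eq_iSup b hle' hsup
  have hβ3 : ∀ n, lam (shift n β) ≤ 3.042 := fun n => (hβx n).trans hx
  have hβ0 : β 0 = true := by
    by_contra h0
    rw [Bool.not_eq_true] at h0
    have hlt : x < 2.5 := by
      rw [← hβ, lam, h0]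
      have k1 := (value_mem fun n => β (n + 1)).2
      have k2 := (value_mem fun n => β (-(n + 1))).2
      have k0 : (digit false : ℝ) = 1 := by norm_num [digit]
      rw [k0]
      norm_num at k1 k2 ⊢
      linarith
    have hall : ∀ n, b n = false := by
      intro n
      by_contra hn
      rw [Bool.not_eq_false] at hn
      have h1 := hle' n
      have k1 := (value_mem fun m => shift n b (m + 1)).1
      have k2 := (value_mem fun m => shift n b (-(m + 1))).1
      have hz : shift n b 0 = true := by simp only [shift, zero_add, hn]
      rw [lam, hz] at h1
      have k0 : (digit true : ℝ) = 2 := by norm_num [digit]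
      rw [k0] at h1
      linarith
    have hconst : ∀ n, shift n b = fun _ => false := fun n => funext fun i => hall _
    simp only [hconst, lam_const_false, ciSup_const] at hsup
    linarith
  refine ⟨_, ⟨_, forward_mem_admissible hβ3, rfl⟩, _, ⟨_, backward_mem_admissible hβ3, rfl⟩, ?_⟩
  rw [← hβ, lam, hβ0]
  rfl

/-! ### An upper bound for the dimension of the Gauss–Cantor set -/

/-- The finite word `l` contains no word of `forbiddenC1`. -/
def allowed (l : List Bool) : Bool :=
  forbiddenC1.all fun w => (List.range (l.length + 1 - w.length)).all fun i =>
    !((List.range w.length).all fun j => digit (l.getD (i + j) false) == w.getD j 0)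

lemma allowed_ofFn {a : ℕ → Bool} (ha : a ∈ admissible) (n : ℕ) :
    allowed (List.ofFn fun j : Fin n => a j) = true := by
  simp only [allowed, List.all_eq_true, Bool.not_eq_true', ← Bool.not_eq_true, List.mem_range,
    List.length_ofFn, beq_iff_eq]
  intro w hw i hi h
  refine ha w hw i fun j hj => ?_
  have := h j hj
  rwa [List.getD_eq_getElem _ _ (by rw [List.length_ofFn]; omega), List.getElem_ofFn] at this

/-- Rational bounds, as pairs of numerator and denominator, for the values of the sequences with
a given prefix. -/
def bounds : List Bool → (ℕ × ℕ) × (ℕ × ℕ)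
  | [] => ((366, 1000), (7321, 10000))
  | b :: l => (((bounds l).2.2, digit b * (bounds l).2.2 + (bounds l).2.1),
      ((bounds l).1.2, digit b * (bounds l).1.2 + (bounds l).1.1))

lemma bounds_pos (l : List Bool) : 0 < (bounds l).1.2 ∧ 0 < (bounds l).2.2 := by
  induction l with
  | nil => decide
  | cons b l ih =>
    exact ⟨Nat.add_pos_left (Nat.mul_pos (one_le_digit b) ih.2) _,
      Nat.add_pos_left (Nat.mul_pos (one_le_digit b) ih.1) _⟩

lemma bounds_spec (l : List Bool) : ∀ a : ℕ → Bool, (∀ j (h : j < l.length), a j = l[j]) →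
    ((bounds l).1.1 / (bounds l).1.2 : ℝ) ≤ value a ∧
      value a ≤ ((bounds l).2.1 / (bounds l).2.2 : ℝ) := by
  induction l with
  | nil =>
    intro a _
    refine ⟨le_trans ?_ (value_mem a).1, (value_mem a).2.trans ?_⟩ <;> norm_num [bounds]
  | cons b l ih =>
    intro a h
    obtain ⟨h1, h2⟩ := ih (tail a) fun j hj => h (j + 1) (by simpa using hj)
    obtain ⟨p1, p2⟩ := bounds_pos l
    have q1 : (0 : ℝ) < (bounds l).1.2 := by exact_mod_cast p1
    have q2 : (0 : ℝ) < (bounds l).2.2 := by exact_mod_cast p2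
    have hd : (1 : ℝ) ≤ digit b := by exact_mod_cast one_le_digit _
    have := value_bounds (h 0 (by simp)) (by positivity) h1 h2
    simp only [bounds]
    push_cast
    convert this using 2
    · simp only [List.getElem_cons_zero]
      field_simp
    · simp only [List.getElem_cons_zero]
      field_simp

/-- The list of weights of the words of length `8`, indexed by binary encoding. -/
def weightTable : List (ℕ × ℕ) :=
  [(0, 300000), (1, 118706), (3, 165623), (6, 112450), (7, 118893), (12, 156642), (14, 75695),
   (15, 89911), (24, 150325), (25, 69447), (28, 106222), (30, 57665), (31, 68503), (48, 173575),
   (49, 33420), (51, 95622), (56, 94266), (57, 51930), (60, 79373), (62, 43095), (63, 51194),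
   (96, 179967), (97, 71181), (99, 48353), (102, 67266), (103, 71114), (112, 136578),
   (115, 75236), (120, 74134), (121, 40839), (124, 62427), (126, 33894), (127, 40264),
   (128, 214925), (129, 85033), (131, 118692), (134, 80502), (135, 85112), (140, 112445),
   (152, 107138), (153, 49495), (156, 75692), (158, 41093), (159, 48815), (192, 164388),
   (193, 65053), (195, 90743), (198, 61655), (204, 85725), (206, 41424), (207, 49204),
   (224, 124374), (225, 49192), (230, 46480), (231, 49139), (240, 94263), (243, 51928),
   (248, 51177), (249, 28193), (252, 43094), (254, 23398), (255, 27795)]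

/-- The weight of a finite word. -/
def weight (l : List Bool) : ℕ :=
  (weightTable.lookup (l.foldl (fun n b => 2 * n + b.toNat) 0)).getD 0 + 1

/-- The eigenvector inequality at a word, for the exponent `79 / 228`. -/
def checkWeight (l : List Bool) : Bool :=
  !allowed l || (0 < (bounds l.tail).1.1 &&
    (weight (l.tail ++ [false]) + weight (l.tail ++ [true])) ^ 114 * (bounds l.tail).1.2 ^ 79 ≤
      weight l ^ 114 *
        (digit (l.headD false) * (bounds l.tail).1.2 + (bounds l.tail).1.1) ^ 79)

lemma checkWeight_eq_true : ∀ b₀ b₁ b₂ b₃ b₄ b₅ b₆ b₇ : Bool,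
    checkWeight [b₀, b₁, b₂, b₃, b₄, b₅, b₆, b₇] = true := by
  decide +kernel

lemma rpow_mul_le_of_pow_le {q D S V : ℕ} (hD : 0 < D)
    (h : S ^ 114 * q ^ 79 ≤ V ^ 114 * D ^ 79) :
    (((q : ℝ) / D) ^ 2) ^ (79 / 228 : ℝ) * S ≤ V := by
  have h' : (S : ℝ) ^ 114 * q ^ 79 ≤ V ^ 114 * D ^ 79 := by exact_mod_cast h
  have hD' : (0 : ℝ) < D := by exact_mod_cast hD
  refine le_of_pow_le_pow_left₀ (n := 114) (by norm_num) (by positivity) ?_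
  have e : ((((q : ℝ) / D) ^ 2) ^ (79 / 228 : ℝ)) ^ 114 = q ^ 79 / D ^ 79 := by
    rw [← Real.rpow_natCast, ← Real.rpow_mul (by positivity), ← Real.rpow_natCast _ 2,
      ← Real.rpow_mul (by positivity), ← div_pow, ← Real.rpow_natCast _ 79]
    norm_num
  rw [mul_pow, e, div_mul_eq_mul_div, div_le_iff₀ (by positivity), mul_comm]
  exact h'

/-- The values of the admissible sequences with a prescribed prefix of length `8`. -/
def piece (i : Fin 8 → Bool) : Set ℝ :=
  {x | ∃ a ∈ admissible, (∀ j : Fin 8, a j = i j) ∧ value a = x}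

lemma allowed_of_mem_piece {i : Fin 8 → Bool} {x : ℝ} (hx : x ∈ piece i) :
    allowed (List.ofFn i) = true := by
  obtain ⟨a, ha, hi, -⟩ := hx
  rw [← funext hi]
  exact allowed_ofFn ha 8

lemma checkWeight_ofFn {i : Fin 8 → Bool} (hi : allowed (List.ofFn i) = true) :
    0 < (bounds (List.ofFn (Fin.tail i))).1.1 ∧
    (weight (List.ofFn (Fin.snoc (α := fun _ => Bool) (Fin.tail i) false)) +
      weight (List.ofFn (Fin.snoc (α := fun _ => Bool) (Fin.tail i) true))) ^ 114 *
        (bounds (List.ofFn (Fin.tail i))).1.2 ^ 79 ≤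
      weight (List.ofFn i) ^ 114 * (digit (i 0) * (bounds (List.ofFn (Fin.tail i))).1.2 +
        (bounds (List.ofFn (Fin.tail i))).1.1) ^ 79 := by
  have h : checkWeight (List.ofFn i) = true := checkWeight_eq_true _ _ _ _ _ _ _ _
  have e : ∀ b, (List.ofFn i).tail ++ [b] =
      List.ofFn (Fin.snoc (α := fun _ => Bool) (Fin.tail i) b) := fun _ => rfl
  have e' : (List.ofFn i).tail = List.ofFn (Fin.tail i) := rfl
  have e'' : (List.ofFn i).headD false = i 0 := rfl
  rw [checkWeight, hi, e, e, e', e''] at h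
  simpa only [Bool.not_true, Bool.false_or, Bool.and_eq_true, decide_eq_true_eq] using h

lemma dist_le_one_of_mem_image {S : Set (ℕ → Bool)} {x y : ℝ} (hx : x ∈ value '' S)
    (hy : y ∈ value '' S) : |x - y| ≤ 1 := by
  obtain ⟨a, -, rfl⟩ := hx
  obtain ⟨b, -, rfl⟩ := hy
  have h1 := value_mem a
  have h2 := value_mem b
  rw [abs_le]
  constructor <;> linarith

lemma dimH_value_admissible_le : dimH (value '' admissible) ≤ ((79 / 228 : NNReal) : ENNReal) := by
  set q : (Fin 8 → Bool) → ℕ := fun i => (bounds (List.ofFn (Fin.tail i))).1.2 with hq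
  set D : (Fin 8 → Bool) → ℕ := fun i => digit (i 0) * (bounds (List.ofFn (Fin.tail i))).1.2 +
    (bounds (List.ofFn (Fin.tail i))).1.1 with hD
  have q_pos : ∀ i, (0 : ℝ) < q i := fun i => by exact_mod_cast (bounds_pos _).1
  have q_le : ∀ i, q i ≤ D i := fun i =>
    (Nat.le_mul_of_pos_left _ (one_le_digit _)).trans (Nat.le_add_right _ _)
  have D_pos : ∀ i, (0 : ℝ) < D i := fun i => (q_pos i).trans_le (by exact_mod_cast q_le i)
  obtain ⟨C, hC⟩ := exists_coveredBy_of_expanding (A := piece)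
    (v := fun i => (weight (List.ofFn i) : ℝ))
    (E := fun i => if allowed (List.ofFn i) then Finset.univ else ∅)
    (P := fun i b => {x | ∃ a ∈ admissible, (∀ j : Fin 8, a j = i j) ∧ a 8 = b ∧ value a = x})
    (T := fun i b => Fin.snoc (α := fun _ => Bool) (Fin.tail i) b)
    (k := fun i _ => ((q i : ℝ) / D i) ^ 2) (s := 79 / 228)
    (by norm_num) (fun i => by exact_mod_cast Nat.succ_pos _)
    (by
      rintro i x ⟨a, ha, -, rfl⟩ y ⟨b, hb, -, rfl⟩
      exact dist_le_one_of_mem_image ⟨a, ha, rfl⟩ ⟨b, hb, rfl⟩)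
    (by
      intro i e he
      have hi : allowed (List.ofFn i) = true := by
        by_contra h
        rw [if_neg h] at he
        exact Finset.notMem_empty _ he
      have hlt : (q i : ℝ) < D i := by
        have := (checkWeight_ofFn hi).1
        have : q i < D i := lt_of_le_of_lt (Nat.le_mul_of_pos_left _ (one_le_digit (i 0)))
          (Nat.lt_add_of_pos_right this)
        exact_mod_cast this
      have hpos := div_pos (q_pos i) (D_pos i)
      exact ⟨pow_pos hpos 2, pow_lt_one₀ hpos.le ((div_lt_one (D_pos i)).2 hlt) two_ne_zero⟩)
    (by
      intro i
      by_cases hi : allowed (List.ofFn i) = true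
      · have h := rpow_mul_le_of_pow_le (q := q i) (D := D i) (Nat.cast_pos.1 (D_pos i))
          (checkWeight_ofFn hi).2
        rw [if_pos hi, Fintype.sum_bool, ← mul_add, add_comm, ← Nat.cast_add]
        exact h
      · rw [if_neg hi, Finset.sum_empty]
        exact Nat.cast_nonneg _)
    (by
      intro i x hx
      simp only [allowed_of_mem_piece hx, if_true, Finset.mem_univ, Set.iUnion_true,
        Set.mem_iUnion]
      obtain ⟨a, h1, h2, h3⟩ := hx
      exact ⟨a 8, a, h1, h2, rfl, h3⟩)
    (by
      intro i e _
      refine ⟨fun y => 1 / y - digit (i 0), ?_, ?_⟩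
      · rintro _ ⟨a, ha, hi, he, rfl⟩
        refine ⟨tail a, tail_mem_admissible ha, ?_, ?_⟩
        · intro j
          induction j using Fin.lastCases with
          | last => exact he.trans (Fin.snoc_last (α := fun _ => Bool) _ _).symm
          | cast j => simpa [tail, Fin.tail] using hi j.succ
        · rw [← hi 0]
          exact (one_div_value_sub a).symm
      · have hval : ∀ a : ℕ → Bool, (∀ j : Fin 8, a j = i j) → value a ≤ q i / D i := by
          intro a hi
          have h := bounds_spec (List.ofFn (Fin.tail i)) (tail a) fun j hj => by
            rw [List.getElem_ofFn]
            exact hi (Fin.succ ⟨j, by simpa using hj⟩)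
          refine (value_bounds (hi 0) (by positivity) h.1 h.2).2.trans_eq ?_
          have := q_pos i
          simp only [hq, hD] at this ⊢
          push_cast
          field_simp
        rintro _ ⟨a, -, ha, -, rfl⟩ _ ⟨b, -, hb, -, rfl⟩
        have h0 : a 0 = i 0 := ha 0
        have h0' : b 0 = i 0 := hb 0
        rw [abs_value_sub_of_head_eq (h0.trans h0'.symm), ← one_div_value_sub a,
          ← one_div_value_sub b, h0, h0', sq]
        have := value_pos b
        have := value_pos a
        gcongr
        · exact hval a ha
        · exact hval b hb)
  refine dimH_le_of_coveredBy (C := ∑ i : Fin 8 → Bool, C * weight (List.ofFn i))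
    fun r h0 h1 => ?_
  rw [Finset.sum_mul]
  push_cast
  refine CoveredBy.biUnion (fun i _ => hC i r h0 h1) ?_
  rintro _ ⟨a, ha, rfl⟩
  simp only [Finset.mem_univ, Set.iUnion_true, Set.mem_iUnion]
  exact ⟨fun j => a j, a, ha, fun _ => rfl, rfl⟩

end ContFrac

/-- `M ∩ (√5, 3.042] ⊆ 2 + K(C₁) + K(C₁)`, and consequently
`dim_H (M ∩ (√5, 3.042]) ≤ 2 · dim_H K(C₁) < 0.693`. -/
theorem markov_cap_sqrt5_3042 :
    (MarkovSpectrum ∩ Set.Ioc (Real.sqrt 5) 3.042 ⊆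
      { z | ∃ x ∈ gaussCantor {1, 2} forbiddenC1, ∃ y ∈ gaussCantor {1, 2} forbiddenC1,
        z = 2 + x + y }) ∧
    dimH (MarkovSpectrum ∩ Set.Ioc (Real.sqrt 5) 3.042) ≤
      2 * dimH (gaussCantor {1, 2} forbiddenC1) ∧
    2 * dimH (gaussCantor {1, 2} forbiddenC1) < ENNReal.ofReal 0.693 := by
  rw [ContFrac.gaussCantor_eq]
  refine ⟨ContFrac.markov_subset, (dimH_mono ContFrac.markov_subset).trans ?_, ?_⟩
  · exact ContFrac.dimH_add_add_le
      (ContFrac.isClosed_admissible.isCompact.image ContFrac.continuous_value)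
      (fun x hx y hy => ContFrac.dist_le_one_of_mem_image hx hy) (c := 40) (by norm_num)
      (fun B hB R hR => ContFrac.exists_expanding
        (fun _ h => ContFrac.tail_mem_admissible h) hB hR) 2
  · calc 2 * dimH (ContFrac.value '' ContFrac.admissible)
        ≤ 2 * ((79 / 228 : NNReal) : ENNReal) := by
          gcongr
          exact ContFrac.dimH_value_admissible_le
      _ = ENNReal.ofReal (79 / 114) := by
          rw [← ENNReal.ofReal_coe_nnreal, ← ENNReal.ofReal_ofNat 2,
            ← ENNReal.ofReal_mul (by norm_num)]
          norm_num
      _ < ENNReal.ofReal 0.693 := by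
          rw [ENNReal.ofReal_lt_ofReal_iff] <;> norm_num
end
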